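/- Let n ≥ 1 and let u : ℝⁿ → ℝ be a smooth function that is semiconvex, i.e. there exists M ∈ ℝ such that D²u(x) + M·Iₙ is positive semidefinite for every x ∈ ℝⁿ. Let g(x) = Iₙ + (D²u(x))·(D²u(x)) be the matrix of the metric induced on the gradient graph Γ = {(x, Du(x)) : x ∈ ℝⁿ} expressed in the x-coordinates. If f : ℝⁿ → ℝ is a bounded smooth function satisfying the Laplace–Beltrami equation ∑_{i,j} ∂_j( √(det g(x)) · (g(x)⁻¹)_{ij} · ∂_i f(x) ) = 0 for all x ∈ ℝⁿ, then f is constant. (In other words, the gradient graph of a semiconvex function is a Liouville manifold.) -/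

import Mathlib

open Matrix MeasureTheory Metric Real

noncomputable section

/-- `ℝⁿ` with the Euclidean structure. -/
abbrev En (n : ℕ) := EuclideanSpace ℝ (Fin n)

/-- The partial derivative `∂ᵢ f (x)`. -/
def pdrv (n : ℕ) (i : Fin n) (f : En n → ℝ) (x : En n) : ℝ :=
  fderiv ℝ f x (EuclideanSpace.single i 1)

/-- The Hessian matrix `D²u(x)`. -/
def hess (n : ℕ) (u : En n → ℝ) (x : En n) : Matrix (Fin n) (Fin n) ℝ :=
  Matrix.of fun i j => pdrv n j (fun y => pdrv n i u y) x

/-- The divergence-form expression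
`∑_{i,j} ∂_j( √(det g(x)) (g(x)⁻¹)_{ij} ∂_i f(x) )` for the Laplace–Beltrami
operator of the metric `g` in coordinates. -/
def lapBel (n : ℕ) (g : En n → Matrix (Fin n) (Fin n) ℝ) (f : En n → ℝ) (x : En n) : ℝ :=
  ∑ i, ∑ j, pdrv n j (fun y => Real.sqrt (g y).det * (g y)⁻¹ i j * pdrv n i f y) x


lemma sobolev_lint_one : ∀ u : En 1 → ℝ, ContDiff ℝ 1 u →
    HasCompactSupport u → ∀ x, ‖u x‖ₑ ≤ ∫⁻ y, ‖fderiv ℝ u y‖ₑ := by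
  intro u hu hc x
  let e : ℝ ≃L[ℝ] En 1 :=
    (ContinuousLinearEquiv.funUnique (Fin 1) ℝ ℝ).symm.trans (EuclideanSpace.equiv (Fin 1) ℝ).symm
  have he : MeasurePreserving e :=
    (PiLp.volume_preserving_toLp (Fin 1)).comp ((volume_preserving_funUnique (Fin 1) ℝ).symm _)
  have hv : ‖e 1‖ = 1 := by
    rw [EuclideanSpace.norm_eq]
    simp [e]
  have h1 : ContDiff ℝ 1 (u ∘ e) := hu.comp e.contDiff
  have h2 : HasCompactSupport (u ∘ e) := hc.comp_homeomorph e.toHomeomorph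
  obtain ⟨t, rfl⟩ := e.surjective x
  have h3 := HasCompactSupport.enorm_le_lintegral_Ici_deriv h1 h2 t
  refine h3.trans ?_
  refine (lintegral_mono' Measure.restrict_le_self le_rfl).trans ?_
  rw [← he.lintegral_comp_emb e.toHomeomorph.measurableEmbedding]
  apply lintegral_mono
  intro s
  have h4 : HasDerivAt (u ∘ e) (fderiv ℝ u (e s) (e 1)) s := by
    have := ((hu.differentiable one_ne_zero) (e s)).hasFDerivAt
    have h5 : HasDerivAt e (e 1) s := by
      have := (e : ℝ →L[ℝ] En 1).hasDerivAt (x := s)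
      simpa using this
    exact this.comp_hasDerivAt s h5
  beta_reduce
  rw [h4.deriv]
  have h6 := (fderiv ℝ u (e s)).le_opNorm (e 1)
  rw [hv, mul_one] at h6
  exact enorm_le_iff_norm_le.2 h6

lemma sobolev_ex (n : ℕ) (hn : 1 ≤ n) : ∃ κ : ℝ, 1 < κ ∧ κ ≤ 2 ∧ ∃ C : ℝ, 1 ≤ C ∧
    ∀ u : En n → ℝ, ContDiff ℝ 1 u → tsupport u ⊆ closedBall 0 2 →
      ∫ x, |u x| ^ κ ≤ C * (∫ x, ‖fderiv ℝ u x‖) ^ κ := by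
  have key : ∃ κ : ℝ, 1 < κ ∧ κ ≤ 2 ∧ ∃ C : NNReal, 
    ∀ u : En n → ℝ, ContDiff ℝ 1 u → tsupport u ⊆ closedBall 0 2 →
      ∫⁻ x, ‖u x‖ₑ ^ κ ≤ C * (∫⁻ x, ‖fderiv ℝ u x‖ₑ) ^ κ := by
    rcases Nat.lt_or_ge 1 n with h | h
    · have hn1 : (1:ℝ) < n := by exact_mod_cast h
      have hn2 : (2:ℝ) ≤ n := by exact_mod_cast h
      have hc : Real.HolderConjugate (n:ℝ) (Real.conjExponent n) := Real.HolderConjugate.conjExponent hn1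
      refine ⟨Real.conjExponent n, hc.symm.lt, ?_, lintegralPowLePowLIntegralFDerivConst (volume : Measure (En n)) (Real.conjExponent n), ?_⟩
      · unfold Real.conjExponent
        rw [div_le_iff₀ (by linarith)]; linarith
      · intro u hu hs
        have hcs : HasCompactSupport u := (isCompact_closedBall _ _).of_isClosed_subset (isClosed_tsupport _) hs
        apply lintegral_pow_le_pow_lintegral_fderiv _ hu hcs
        simpa using hc
    · obtain rfl : n = 1 := le_antisymm h hn
      refine ⟨2, by norm_num, le_rfl, (volume (closedBall (0:En 1) 2)).toNNReal, ?_⟩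
      intro u hu hs
      have hcs : HasCompactSupport u := (isCompact_closedBall _ _).of_isClosed_subset (isClosed_tsupport _) hs
      have hb := sobolev_lint_one u hu hcs
      calc ∫⁻ x, ‖u x‖ₑ ^ (2:ℝ) = ∫⁻ x in closedBall 0 2, ‖u x‖ₑ ^ (2:ℝ) := by
            rw [← lintegral_indicator measurableSet_closedBall]
            congr 1
            ext x
            by_cases hx : x ∈ closedBall (0:En 1) 2
            · simp [Set.indicator_of_mem hx]
            · have : u x = 0 := image_eq_zero_of_notMem_tsupport (fun h => hx (hs h))
              simp [Set.indicator_of_notMem hx, this]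
        _ ≤ ∫⁻ x in closedBall (0:En 1) 2, (∫⁻ x, ‖fderiv ℝ u x‖ₑ) ^ (2:ℝ) := by
            apply lintegral_mono; intro x; exact ENNReal.rpow_le_rpow (hb x) (by norm_num)
        _ = _ := by
            rw [setLIntegral_const, ENNReal.coe_toNNReal (measure_closedBall_lt_top).ne, mul_comm]
  obtain ⟨κ, h1, h2, C, hC⟩ := key
  refine ⟨κ, h1, h2, max C 1, le_max_right _ _, ?_⟩
  intro u hu hs
  have hcs : HasCompactSupport u := (isCompact_closedBall _ _).of_isClosed_subset (isClosed_tsupport _) hs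
  have hk := hC u hu hs
  have hcont : Continuous (fderiv ℝ u) := hu.continuous_fderiv one_ne_zero
  have e2 : ∫⁻ x, ‖fderiv ℝ u x‖ₑ = ENNReal.ofReal (∫ x, ‖fderiv ℝ u x‖) := by
    rw [ofReal_integral_norm_eq_lintegral_enorm]
    exact hcont.integrable_of_hasCompactSupport (hcs.fderiv ℝ)
  have e1 : ∫ x, |u x| ^ κ = (∫⁻ x, ‖u x‖ₑ ^ κ).toReal := by
    rw [integral_eq_lintegral_of_nonneg_ae]
    · congr 2
      ext x
      rw [← Real.norm_eq_abs, ← ofReal_norm, ENNReal.ofReal_rpow_of_nonneg (norm_nonneg _) (by linarith)]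
    · exact Filter.Eventually.of_forall (fun x => by positivity)
    · exact (hu.continuous.abs.rpow_const (fun x => Or.inr (by linarith))).aestronglyMeasurable
  have h0 : 0 ≤ ∫ x, ‖fderiv ℝ u x‖ := integral_nonneg (fun x => norm_nonneg _)
  rw [e1]
  have h3 : (∫⁻ x, ‖u x‖ₑ ^ κ).toReal ≤ (C * (∫⁻ x, ‖fderiv ℝ u x‖ₑ) ^ κ).toReal := by
    apply ENNReal.toReal_mono _ hk
    rw [e2, ENNReal.ofReal_rpow_of_nonneg h0 (by linarith)]
    exact ENNReal.mul_ne_top ENNReal.coe_ne_top ENNReal.ofReal_ne_top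
  refine h3.trans ?_
  rw [e2, ENNReal.ofReal_rpow_of_nonneg h0 (by linarith), ENNReal.toReal_mul, ENNReal.toReal_ofReal (by positivity)]
  simp only [ENNReal.coe_toReal]
  gcongr
  exact le_max_left _ _

lemma cutoff_ex (n : ℕ) : ∃ K : ℝ, 1 ≤ K ∧ ∀ r s : ℝ, 0 < r → r < s →
    ∃ η : En n → ℝ, ContDiff ℝ 1 η ∧ (∀ x, 0 ≤ η x) ∧ (∀ x, η x ≤ 1) ∧
      (∀ x ∈ closedBall (0:En n) r, η x = 1) ∧ (∀ x, x ∉ ball (0:En n) s → η x = 0) ∧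
      tsupport η ⊆ closedBall 0 s ∧ HasCompactSupport η ∧
      (∀ x, ‖fderiv ℝ η x‖ ≤ K / (s - r)) := by
  have hT : ContDiff ℝ 1 Real.smoothTransition := Real.smoothTransition.contDiff
  have hd : Continuous (deriv Real.smoothTransition) := hT.continuous_deriv le_rfl
  obtain ⟨K0, hK0⟩ := (isCompact_Icc (a := (0:ℝ)) (b := 1)).exists_bound_of_continuousOn hd.continuousOn
  have hKK : ∀ t, ‖deriv Real.smoothTransition t‖ ≤ max K0 0 := by
    intro t
    by_cases h : t ∈ Set.Icc (0:ℝ) 1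
    · exact (hK0 t h).trans (le_max_left _ _)
    · have : deriv Real.smoothTransition t = 0 := by
        rw [Set.mem_Icc, not_and_or, not_le, not_le] at h
        rcases h with h | h
        · have : Real.smoothTransition =ᶠ[nhds t] fun _ => 0 := by
            filter_upwards [Iio_mem_nhds h] with y hy
            exact Real.smoothTransition.zero_of_nonpos (le_of_lt hy)
          rw [this.deriv_eq]; simp
        · have : Real.smoothTransition =ᶠ[nhds t] fun _ => 1 := by
            filter_upwards [Ioi_mem_nhds h] with y hy
            exact Real.smoothTransition.one_of_one_le (le_of_lt hy)
          rw [this.deriv_eq]; simp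
      rw [this]; simp
  refine ⟨2 * max K0 0 + 1, by have := le_max_right K0 0; linarith, ?_⟩
  intro r s hr hrs
  have hden : 0 < s ^ 2 - r ^ 2 := by nlinarith
  let q : En n → ℝ := fun x => (s ^ 2 - ‖x‖ ^ 2) / (s ^ 2 - r ^ 2)
  have hq : ContDiff ℝ 1 q := (contDiff_const.sub (contDiff_norm_sq ℝ)).div_const _
  have hz : ∀ x, x ∉ ball (0:En n) s → Real.smoothTransition (q x) = 0 := by
    intro x hx
    apply Real.smoothTransition.zero_of_nonpos
    have : s ≤ ‖x‖ := by simpa using hx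
    apply div_nonpos_of_nonpos_of_nonneg _ hden.le
    nlinarith
  have hts : tsupport (fun x => Real.smoothTransition (q x)) ⊆ closedBall (0:En n) s := by
    apply closure_minimal _ isClosed_closedBall
    intro x hx
    by_contra h
    exact hx (hz x (fun h' => h (ball_subset_closedBall h')))
  refine ⟨fun x => Real.smoothTransition (q x), hT.comp hq, fun x => Real.smoothTransition.nonneg _,
    fun x => Real.smoothTransition.le_one _, ?_, hz, hts, ?_, ?_⟩
  · intro x hx
    apply Real.smoothTransition.one_of_one_le
    have : ‖x‖ ≤ r := by simpa using hx
    rw [le_div_iff₀ hden]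
    nlinarith [norm_nonneg x]
  · exact (isCompact_closedBall _ _).of_isClosed_subset (isClosed_tsupport _) hts
  · intro x
    have hsr : 0 < s - r := by linarith
    by_cases hx : x ∈ closedBall (0:En n) s
    swap
    · have : fderiv ℝ (fun x => Real.smoothTransition (q x)) x = 0 := by
        by_contra h
        exact hx (hts (support_fderiv_subset ℝ h))
      rw [this, norm_zero]
      have := le_max_right K0 0
      positivity
    have hx' : ‖x‖ ≤ s := by simpa using hx
    have h1 : HasFDerivAt q ((s ^ 2 - r ^ 2)⁻¹ • (-((2:ℕ) • (innerSL ℝ x : En n →L[ℝ] ℝ)) : En n →L[ℝ] ℝ)) x := by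
      have := ((hasStrictFDerivAt_norm_sq x).hasFDerivAt.const_sub (s^2)).const_mul ((s ^ 2 - r ^ 2)⁻¹)
      refine this.congr_of_eventuallyEq (Filter.Eventually.of_forall fun y => ?_)
      simp [q, div_eq_inv_mul]
    have h2 : HasDerivAt Real.smoothTransition (deriv Real.smoothTransition (q x)) (q x) :=
      (hT.differentiable one_ne_zero _).hasDerivAt
    have h3 := h2.comp_hasFDerivAt x h1
    have h4 : fderiv ℝ (fun x => Real.smoothTransition (q x)) x = _ := h3.fderiv
    rw [h4, norm_smul, norm_smul, norm_neg, ← Nat.cast_smul_eq_nsmul ℝ, norm_smul, innerSL_apply_norm]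
    have h5 := hKK (q x)
    have h6 : ‖(s ^ 2 - r ^ 2)⁻¹‖ * (‖((2:ℕ):ℝ)‖ * ‖x‖) ≤ 2 / (s - r) := by
      rw [Real.norm_of_nonneg (by positivity)]
      rw [inv_mul_le_iff₀ hden]
      have : (s ^ 2 - r ^ 2) * (2 / (s - r)) = 2 * (s + r) := by
        field_simp; ring
      rw [this]
      simp
      linarith
    calc _ ≤ max K0 0 * (2 / (s - r)) := by
          apply mul_le_mul h5 h6 (by positivity) (le_max_right _ _)
      _ ≤ _ := by
          rw [mul_div_assoc']
          gcongr
          linarith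

lemma lint_smul_add (n : ℕ) (G : En n → ENNReal) (hG : Measurable G) (c : En n) (r : ℝ)
    (hr : 1 / 2 ≤ r) : ∫⁻ y, G (r • y + c) ≤ 2 ^ n * ∫⁻ y, G y := by
  have hr0 : r ≠ 0 := by intro h; rw [h] at hr; norm_num at hr
  have h1 : ∫⁻ y, G (r • y + c) = ∫⁻ y, G (y + c) ∂(Measure.map (fun x => r • x) volume) := by
    rw [lintegral_map (f := fun y => G (y + c)) (g := fun x : En n => r • x) (by fun_prop) (by fun_prop)]
  rw [h1, Measure.map_addHaar_smul _ hr0, lintegral_smul_measure, lintegral_add_right_eq_self, smul_eq_mul]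
  gcongr
  have : |(r ^ Module.finrank ℝ (En n))⁻¹| ≤ 2 ^ n := by
    rw [abs_of_nonneg (by positivity)]
    simp only [finrank_euclideanSpace, Fintype.card_fin]
    rw [← inv_pow]
    gcongr
    rw [inv_le_comm₀ (by linarith) (by norm_num)]
    linarith
  calc _ ≤ ENNReal.ofReal (2 ^ n) := ENNReal.ofReal_le_ofReal this
    _ = _ := by rw [ENNReal.ofReal_pow (by norm_num)]; simp

lemma poincare_lint (n : ℕ) (w : En n → ℝ) (hw : ContDiff ℝ 1 w) (Z : Set (En n))
    (hZm : MeasurableSet Z) (hZ : Z ⊆ ball 0 1) (hw0 : ∀ x ∈ Z, w x = 0) :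
    volume Z * ∫⁻ x in ball (0 : En n) 1, ‖w x‖ₑ ≤
      2 * (2 ^ n * volume (ball (0 : En n) 1)) * ∫⁻ x in ball (0 : En n) 1, ‖fderiv ℝ w x‖ₑ := by
  set B := ball (0 : En n) 1 with hB
  have hcont : Continuous (fderiv ℝ w) := hw.continuous_fderiv one_ne_zero
  let G : En n → ENNReal := B.indicator (fun x => ‖fderiv ℝ w x‖ₑ)
  have hG : Measurable G := (hcont.enorm.measurable).indicator measurableSet_ball
  have hGi : ∫⁻ x, G x = ∫⁻ x in B, ‖fderiv ℝ w x‖ₑ := lintegral_indicator measurableSet_ball _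
  -- pointwise
  have hpt : ∀ x ∈ B, ∀ y ∈ B, ‖w x - w y‖ₑ ≤ ∫⁻ t in Set.Ioc (0:ℝ) 1, 2 * G ((1 - t) • y + t • x) := by
    intro x hx y hy
    have hd : ∀ t ∈ Set.uIcc (0:ℝ) 1, HasDerivAt (fun t : ℝ => w ((1 - t) • y + t • x))
        (fderiv ℝ w ((1 - t) • y + t • x) (x - y)) t := by
      intro t _
      have h1 : HasDerivAt (fun t : ℝ => (1 - t) • y + t • x) (x - y) t := by
        have := (((hasDerivAt_id t).const_sub 1).smul_const y).add ((hasDerivAt_id t).smul_const x)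
        exact this.congr_deriv (by simp [sub_eq_neg_add])
      exact ((hw.differentiable one_ne_zero) _).hasFDerivAt.comp_hasDerivAt t h1
    have hc : Continuous (fun t : ℝ => fderiv ℝ w ((1 - t) • y + t • x) (x - y)) := by
      have : Continuous (fun t : ℝ => (1 - t) • y + t • x) := by fun_prop
      exact (hcont.comp this).clm_apply continuous_const
    have h2 := intervalIntegral.integral_eq_sub_of_hasDerivAt hd (hc.intervalIntegrable _ _)
    have h3 : w x - w y = ∫ t in Set.Ioc (0:ℝ) 1, fderiv ℝ w ((1 - t) • y + t • x) (x - y) := by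
      rw [← intervalIntegral.integral_of_le zero_le_one, h2]
      simp
    rw [h3]
    refine (enorm_integral_le_lintegral_enorm _).trans ?_
    apply setLIntegral_mono' measurableSet_Ioc
    intro t ht
    have hmem : (1 - t) • y + t • x ∈ B :=
      (convex_ball (0 : En n) 1) hy hx (by linarith [ht.2]) ht.1.le (by ring)
    have hGe : G ((1 - t) • y + t • x) = ‖fderiv ℝ w ((1 - t) • y + t • x)‖ₑ :=
      Set.indicator_of_mem hmem _
    rw [hGe]
    have hxy : ‖x - y‖ ≤ 2 := by
      have h4 : ‖x‖ < 1 := by simpa [hB] using hx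
      have h5 : ‖y‖ < 1 := by simpa [hB] using hy
      linarith [norm_sub_le x y]
    have h6 : ‖fderiv ℝ w ((1 - t) • y + t • x) (x - y)‖ ≤ 2 * ‖fderiv ℝ w ((1 - t) • y + t • x)‖ := by
      refine (ContinuousLinearMap.le_opNorm _ _).trans ?_
      nlinarith [norm_nonneg (fderiv ℝ w ((1 - t) • y + t • x))]
    calc _ = ENNReal.ofReal ‖fderiv ℝ w ((1 - t) • y + t • x) (x - y)‖ := (ofReal_norm _).symm
      _ ≤ ENNReal.ofReal (2 * ‖fderiv ℝ w ((1 - t) • y + t • x)‖) := ENNReal.ofReal_le_ofReal h6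
      _ = _ := by rw [ENNReal.ofReal_mul (by norm_num), ofReal_norm]; simp
  -- for fixed t
  have hmeas : Measurable (fun p : En n × En n × ℝ => G ((1 - p.2.2) • p.2.1 + p.2.2 • p.1)) := by
    apply hG.comp
    fun_prop
  have ht : ∀ t ∈ Set.Ioc (0:ℝ) 1, ∫⁻ x in B, ∫⁻ y in B, G ((1 - t) • y + t • x) ≤
      (2 ^ n * volume B) * ∫⁻ x in B, ‖fderiv ℝ w x‖ₑ := by
    intro t ht
    rw [← hGi]
    rcases le_total t (1/2) with h | h
    · calc ∫⁻ x in B, ∫⁻ y in B, G ((1 - t) • y + t • x) 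
          ≤ ∫⁻ x in B, 2 ^ n * ∫⁻ y, G y := by
            apply lintegral_mono
            intro x
            refine (lintegral_mono' Measure.restrict_le_self le_rfl).trans ?_
            exact lint_smul_add n G hG (t • x) (1 - t) (by linarith)
        _ = _ := by rw [setLIntegral_const]; ring
    · rw [lintegral_lintegral_swap]
      · calc
          ∫⁻ y in B, ∫⁻ x in B, G ((1 - t) • y + t • x) ≤ ∫⁻ y in B, 2 ^ n * ∫⁻ y, G y := by
            apply lintegral_mono
            intro y
            refine (lintegral_mono' Measure.restrict_le_self le_rfl).trans ?_
            simp_rw [add_comm ((1 - t) • y)]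
            exact lint_smul_add n G hG ((1 - t) • y) t (by linarith)
          _ = _ := by rw [setLIntegral_const]; ring
      · apply Measurable.aemeasurable
        apply hG.comp
        fun_prop
  have e1 : volume Z * ∫⁻ x in B, ‖w x‖ₑ = ∫⁻ x in B, ∫⁻ y in Z, ‖w x - w y‖ₑ := by
    rw [← lintegral_const_mul _ hw.continuous.enorm.measurable]
    congr 1
    ext x
    have : ∫⁻ y in Z, ‖w x - w y‖ₑ = ∫⁻ y in Z, ‖w x‖ₑ := by
      apply setLIntegral_congr_fun hZm
      intro y hy
      simp [hw0 y hy]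
    rw [this, setLIntegral_const, mul_comm]
  rw [e1]
  calc ∫⁻ x in B, ∫⁻ y in Z, ‖w x - w y‖ₑ 
      ≤ ∫⁻ x in B, ∫⁻ y in B, ∫⁻ t in Set.Ioc (0:ℝ) 1, 2 * G ((1 - t) • y + t • x) := by
        apply setLIntegral_mono' measurableSet_ball
        intro x hx
        refine (lintegral_mono_set hZ).trans ?_
        apply setLIntegral_mono' measurableSet_ball
        intro y hy
        exact hpt x hx y hy
    _ = ∫⁻ x in B, ∫⁻ t in Set.Ioc (0:ℝ) 1, ∫⁻ y in B, 2 * G ((1 - t) • y + t • x) := by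
        congr 1
        ext x
        apply lintegral_lintegral_swap
        apply Measurable.aemeasurable
        apply Measurable.const_mul
        apply hG.comp
        fun_prop
    _ = ∫⁻ t in Set.Ioc (0:ℝ) 1, ∫⁻ x in B, ∫⁻ y in B, 2 * G ((1 - t) • y + t • x) := by
        apply lintegral_lintegral_swap
        apply Measurable.aemeasurable
        apply Measurable.lintegral_prod_right' (f := fun q : (En n × ℝ) × En n => 2 * G ((1 - q.1.2) • q.2 + q.1.2 • q.1.1))
        apply Measurable.const_mul
        apply hG.comp
        fun_prop
    _ ≤ ∫⁻ t in Set.Ioc (0:ℝ) 1, 2 * ((2 ^ n * volume B) * ∫⁻ x in B, ‖fderiv ℝ w x‖ₑ) := by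
        apply setLIntegral_mono' measurableSet_Ioc
        intro t h
        refine le_trans (le_of_eq ?_) (mul_le_mul_right (ht t h) 2)
        rw [← lintegral_const_mul']
        · congr 1
          ext x
          rw [lintegral_const_mul' _ _ (by simp)]
        · simp
    _ = _ := by
        rw [setLIntegral_const]
        simp; ring

lemma poincare (n : ℕ) (w : En n → ℝ) (hw : ContDiff ℝ 1 w) (Z : Set (En n))
    (hZm : MeasurableSet Z) (hZ : Z ⊆ ball 0 1) (hw0 : ∀ x ∈ Z, w x = 0) :
    (volume Z).toReal * ∫ x in ball (0 : En n) 1, |w x| ≤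
      2 * (2 ^ n * (volume (ball (0 : En n) 1)).toReal) * ∫ x in ball (0 : En n) 1, ‖fderiv ℝ w x‖ := by
  have h := poincare_lint n w hw Z hZm hZ hw0
  have hcont : Continuous (fderiv ℝ w) := hw.continuous_fderiv one_ne_zero
  have i1 : IntegrableOn w (ball (0 : En n) 1) :=
    (hw.continuous.continuousOn.integrableOn_compact (isCompact_closedBall 0 1)).mono_set ball_subset_closedBall
  have i2 : IntegrableOn (fderiv ℝ w) (ball (0 : En n) 1) :=
    (hcont.continuousOn.integrableOn_compact (isCompact_closedBall 0 1)).mono_set ball_subset_closedBall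
  rw [← ofReal_integral_norm_eq_lintegral_enorm i1, ← ofReal_integral_norm_eq_lintegral_enorm i2] at h
  have h' := ENNReal.toReal_mono ?_ h
  · simp only [ENNReal.toReal_mul] at h'
    rw [ENNReal.toReal_ofReal (integral_nonneg (fun x => norm_nonneg _)),
      ENNReal.toReal_ofReal (integral_nonneg (fun x => norm_nonneg _))] at h'
    simpa using h'
  · refine ENNReal.mul_ne_top (ENNReal.mul_ne_top (by simp) (ENNReal.mul_ne_top (by simp) measure_ball_lt_top.ne)) ENNReal.ofReal_ne_top

section
set_option maxSynthPendingDepth 3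
/-- uniformly elliptic continuous coefficients, as bilinear forms on covectors -/
structure Ell (n : ℕ) (a : En n → (En n →L[ℝ] ℝ) →L[ℝ] (En n →L[ℝ] ℝ) →L[ℝ] ℝ) (lam Lam : ℝ) : Prop where
  lam_pos : 0 < lam
  Lam_nonneg : 0 ≤ Lam
  cont : Continuous a
  lower : ∀ y ξ, lam * ‖ξ‖ ^ 2 ≤ a y ξ ξ
  upper : ∀ y ξ ζ, |a y ξ ζ| ≤ Lam * ‖ξ‖ * ‖ζ‖

/-- weak solutions of the divergence form equation -/
def WeakSol (n : ℕ) (a : En n → (En n →L[ℝ] ℝ) →L[ℝ] (En n →L[ℝ] ℝ) →L[ℝ] ℝ) (f : En n → ℝ) : Prop :=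
  ∀ φ : En n → ℝ, ContDiff ℝ 1 φ → HasCompactSupport φ →
    ∫ y, a y (fderiv ℝ f y) (fderiv ℝ φ y) = 0

/-- weak form of `div (a ∇ w) ≥ a (∇ w, ∇ w)` -/
def LogSub (n : ℕ) (a : En n → (En n →L[ℝ] ℝ) →L[ℝ] (En n →L[ℝ] ℝ) →L[ℝ] ℝ) (w : En n → ℝ) : Prop :=
  ∀ φ : En n → ℝ, ContDiff ℝ 1 φ → HasCompactSupport φ → (∀ x, 0 ≤ φ x) →
    ∫ y, (a y (fderiv ℝ w y) (fderiv ℝ φ y) + φ y * a y (fderiv ℝ w y) (fderiv ℝ w y)) ≤ 0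

lemma integrable_off {n : ℕ} {η F : En n → ℝ} (hη : HasCompactSupport η) (hF : Continuous F)
    (h : ∀ x, x ∉ tsupport η → F x = 0) : Integrable F :=
  hF.integrable_of_hasCompactSupport (HasCompactSupport.intro hη h)

lemma fderiv_off {n : ℕ} {η : En n → ℝ} {x : En n} (h : x ∉ tsupport η) : fderiv ℝ η x = 0 := by
  by_contra h'
  exact h (support_fderiv_subset ℝ h')

lemma energy {n : ℕ} {a : En n → (En n →L[ℝ] ℝ) →L[ℝ] (En n →L[ℝ] ℝ) →L[ℝ] ℝ} {lam Lam : ℝ}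
    (ha : Ell n a lam Lam) {w : En n → ℝ} (hw : ContDiff ℝ 1 w) (hw1 : ∀ x, 1 ≤ w x)
    (hs : LogSub n a w) {η : En n → ℝ} (hη : ContDiff ℝ 1 η) (hc : HasCompactSupport η)
    {q : ℝ} (hq : 0 ≤ q) :
    ∫ x, η x ^ 2 * w x ^ q * ‖fderiv ℝ w x‖ ^ 2 ≤
      (4 * Lam ^ 2 / lam ^ 2) * ∫ x, w x ^ q * ‖fderiv ℝ η x‖ ^ 2 := by
  have hlam := ha.lam_pos
  have hLam := ha.Lam_nonneg
  have hwpos : ∀ x, 0 < w x := fun x => lt_of_lt_of_le one_pos (hw1 x)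
  have cDw : Continuous (fderiv ℝ w) := hw.continuous_fderiv one_ne_zero
  have cDη : Continuous (fderiv ℝ η) := hη.continuous_fderiv one_ne_zero
  have hpw : ∀ q : ℝ, ContDiff ℝ 1 (fun x => w x ^ q) := fun q =>
    hw.rpow_const_of_ne (fun x => (hwpos x).ne')
  let φ : En n → ℝ := fun x => η x ^ 2 * w x ^ q
  have hφ : ContDiff ℝ 1 φ := (hη.pow 2).mul (hpw q)
  have hφc : HasCompactSupport φ := by
    apply HasCompactSupport.intro hc
    intro x hx
    simp [φ, image_eq_zero_of_notMem_tsupport hx]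
  have hφ0 : ∀ x, 0 ≤ φ x := fun x => mul_nonneg (sq_nonneg _) (Real.rpow_nonneg (hwpos x).le _)
  have hD : ∀ x, fderiv ℝ φ x = (2 * η x * w x ^ q) • fderiv ℝ η x +
      (η x ^ 2 * (q * w x ^ (q - 1))) • fderiv ℝ w x := by
    intro x
    have h1 : HasFDerivAt η (fderiv ℝ η x) x := (hη.differentiable one_ne_zero x).hasFDerivAt
    have h2 : HasFDerivAt w (fderiv ℝ w x) x := (hw.differentiable one_ne_zero x).hasFDerivAt
    have h3 := (h1.pow 2).mul (h2.rpow_const (p := q) (Or.inl (hwpos x).ne'))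
    have h4 : fderiv ℝ φ x = _ := h3.fderiv
    rw [h4]
    ext v
    simp
    ring
  have h0 := hs φ hφ hφc hφ0
  have i1 : Integrable (fun x => η x ^ 2 * w x ^ q * ‖fderiv ℝ w x‖ ^ 2) := by
    apply integrable_off hc
    · exact (hφ.continuous).mul (cDw.norm.pow 2)
    · intro x hx; simp [image_eq_zero_of_notMem_tsupport hx]
  have i2 : Integrable (fun x => w x ^ q * ‖fderiv ℝ η x‖ ^ 2) := by
    apply integrable_off hc
    · exact ((hpw q).continuous).mul (cDη.norm.pow 2)
    · intro x hx; simp [fderiv_off hx]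
  have i3 : Integrable (fun y => (a y (fderiv ℝ w y) (fderiv ℝ φ y) + φ y * a y (fderiv ℝ w y) (fderiv ℝ w y))) := by
    apply integrable_off hφc
    · exact ((ha.cont.clm_apply cDw).clm_apply (hφ.continuous_fderiv one_ne_zero)).add
        (hφ.continuous.mul ((ha.cont.clm_apply cDw).clm_apply cDw))
    · intro x hx; simp [fderiv_off hx, image_eq_zero_of_notMem_tsupport hx]
  have hpt : ∀ x, (lam / 2) * (η x ^ 2 * w x ^ q * ‖fderiv ℝ w x‖ ^ 2) -
      (2 * Lam ^ 2 / lam) * (w x ^ q * ‖fderiv ℝ η x‖ ^ 2) ≤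
      a x (fderiv ℝ w x) (fderiv ℝ φ x) + φ x * a x (fderiv ℝ w x) (fderiv ℝ w x) := by
    intro x
    rw [hD x]
    simp only [map_add, map_smul, smul_eq_mul, φ]
    set A := a x (fderiv ℝ w x) (fderiv ℝ w x) with hA
    set Bq := a x (fderiv ℝ w x) (fderiv ℝ η x) with hBq
    have hA1 : lam * ‖fderiv ℝ w x‖ ^ 2 ≤ A := ha.lower x _
    have hA0 : 0 ≤ A := le_trans (by positivity) hA1
    have hB1 : |Bq| ≤ Lam * ‖fderiv ℝ w x‖ * ‖fderiv ℝ η x‖ := ha.upper x _ _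
    have hW : 0 ≤ w x ^ q := Real.rpow_nonneg (hwpos x).le _
    have hW1 : 0 ≤ w x ^ (q - 1) := Real.rpow_nonneg (hwpos x).le _
    set W := w x ^ q
    set X := ‖fderiv ℝ w x‖
    set Y := ‖fderiv ℝ η x‖
    have hX : 0 ≤ X := norm_nonneg _
    have hY : 0 ≤ Y := norm_nonneg _
    have e1 : 0 ≤ η x ^ 2 * (q * w x ^ (q - 1)) * A := by positivity
    have e2 : |η x * Bq| ≤ |η x| * (Lam * X * Y) := by
      rw [abs_mul]; gcongr
    have e3 : 2 * (|η x| * (Lam * X * Y)) ≤ (lam / 2) * (η x ^ 2 * X ^ 2) + (2 * Lam ^ 2 / lam) * Y ^ 2 := by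
      have h5 : 0 ≤ (lam * (|η x| * X) - 2 * (Lam * Y)) ^ 2 / (2 * lam) := by positivity
      have h6 : (lam * (|η x| * X) - 2 * (Lam * Y)) ^ 2 / (2 * lam) =
        (lam / 2) * (|η x| ^ 2 * X ^ 2) + (2 * Lam ^ 2 / lam) * Y ^ 2 - 2 * (|η x| * (Lam * X * Y)) := by
        field_simp; ring
      rw [sq_abs] at h6
      linarith
    have e4 : -(|η x| * (Lam * X * Y)) ≤ η x * Bq := (neg_le_neg e2).trans (neg_abs_le _)
    have e5 : W * (2 * (η x * Bq)) ≥ - (W * ((lam / 2) * (η x ^ 2 * X ^ 2) + (2 * Lam ^ 2 / lam) * Y ^ 2)) := by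
      have : -((lam / 2) * (η x ^ 2 * X ^ 2) + (2 * Lam ^ 2 / lam) * Y ^ 2) ≤ 2 * (η x * Bq) := by linarith
      have := mul_le_mul_of_nonneg_left this hW
      linarith
    have e6 : η x ^ 2 * W * (lam * X ^ 2) ≤ η x ^ 2 * W * A := by gcongr
    nlinarith [e1, e5, e6]
  have h7 := integral_mono ((i1.const_mul (lam / 2)).sub (i2.const_mul (2 * Lam ^ 2 / lam))) i3 hpt
  have h8 := h7.trans h0
  rw [integral_sub' (i1.const_mul (lam / 2)) (i2.const_mul (2 * Lam ^ 2 / lam)), integral_const_mul, integral_const_mul] at h8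
  have h9 : (lam / 2) * ∫ x, η x ^ 2 * w x ^ q * ‖fderiv ℝ w x‖ ^ 2 ≤
    (2 * Lam ^ 2 / lam) * ∫ x, w x ^ q * ‖fderiv ℝ η x‖ ^ 2 := by linarith
  have h10 : (4 * Lam ^ 2 / lam ^ 2) = (lam / 2)⁻¹ * (2 * Lam ^ 2 / lam) := by
    field_simp; ring
  rw [h10, mul_assoc, ← div_eq_inv_mul, le_div_iff₀ (by positivity)]
  linarith

lemma contDiff_comp_one {n : ℕ} {f : En n → ℝ} (hf : ContDiff ℝ 1 f) (hpos : ∀ x, 0 < f x)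
    {Φ Φ1 : ℝ → ℝ} (h1 : ∀ s, 0 < s → HasDerivAt Φ (Φ1 s) s) (h2 : ContinuousOn Φ1 (Set.Ioi 0)) :
    ContDiff ℝ 1 (fun x => Φ (f x)) ∧ ∀ x, fderiv ℝ (fun x => Φ (f x)) x = Φ1 (f x) • fderiv ℝ f x := by
  have hd : ∀ x, HasFDerivAt (fun x => Φ (f x)) (Φ1 (f x) • fderiv ℝ f x) x := by
    intro x
    exact (h1 (f x) (hpos x)).comp_hasFDerivAt x (hf.differentiable one_ne_zero x).hasFDerivAt
  refine ⟨?_, fun x => (hd x).fderiv⟩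
  rw [contDiff_one_iff_hasFDerivAt]
  refine ⟨_, ?_, hd⟩
  exact (h2.comp_continuous hf.continuous hpos).smul (hf.continuous_fderiv one_ne_zero)

lemma logsub_of_sol {n : ℕ} {a : En n → (En n →L[ℝ] ℝ) →L[ℝ] (En n →L[ℝ] ℝ) →L[ℝ] ℝ} {lam Lam : ℝ}
    (ha : Ell n a lam Lam) {f : En n → ℝ} (hf : ContDiff ℝ 1 f) (hpos : ∀ x, 0 < f x)
    (hs : WeakSol n a f) {Φ Φ1 Φ2 : ℝ → ℝ} (h1 : ∀ s, 0 < s → HasDerivAt Φ (Φ1 s) s)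
    (h2 : ∀ s, 0 < s → HasDerivAt Φ1 (Φ2 s) s) (h3 : ContinuousOn Φ2 (Set.Ioi 0))
    (h4 : ∀ s, 0 < s → Φ1 s ^ 2 ≤ Φ2 s) : LogSub n a (fun x => Φ (f x)) := by
  intro φ hφ hc hφ0
  have hc1 : ContinuousOn Φ1 (Set.Ioi 0) := fun s hs => (h2 s hs).continuousAt.continuousWithinAt
  obtain ⟨w1, w2⟩ := contDiff_comp_one hf hpos h1 hc1
  obtain ⟨g1, g2⟩ := contDiff_comp_one hf hpos h2 h3
  have cDf : Continuous (fderiv ℝ f) := hf.continuous_fderiv one_ne_zero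
  have cDw := w1.continuous_fderiv one_ne_zero
  let ψ : En n → ℝ := fun x => Φ1 (f x) * φ x
  have hψ : ContDiff ℝ 1 ψ := g1.mul hφ
  have hψc : HasCompactSupport ψ := hc.mul_left
  have hD : ∀ x, fderiv ℝ ψ x = Φ1 (f x) • fderiv ℝ φ x + (φ x * Φ2 (f x)) • fderiv ℝ f x := by
    intro x
    have := fderiv_fun_mul (g1.differentiable one_ne_zero x) (hφ.differentiable one_ne_zero x)
    simp only [ψ]
    rw [this, g2, smul_smul]
  have h0 := hs ψ hψ hψc
  rw [← h0]
  apply integral_mono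
  · apply integrable_off hc
    · exact ((ha.cont.clm_apply cDw).clm_apply (hφ.continuous_fderiv one_ne_zero)).add
        (hφ.continuous.mul ((ha.cont.clm_apply cDw).clm_apply cDw))
    · intro x hx; simp [fderiv_off hx, image_eq_zero_of_notMem_tsupport hx]
  · apply integrable_off hψc
    · exact ((ha.cont.clm_apply cDf).clm_apply (hψ.continuous_fderiv one_ne_zero))
    · intro x hx; simp [fderiv_off hx]
  · intro x
    beta_reduce
    rw [hD, w2]
    simp only [map_add, map_smul, smul_eq_mul, _root_.smul_apply]
    have hA : 0 ≤ a x (fderiv ℝ f x) (fderiv ℝ f x) :=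
      le_trans (mul_nonneg ha.lam_pos.le (sq_nonneg _)) (ha.lower x _)
    have := mul_le_mul_of_nonneg_right (mul_le_mul_of_nonneg_left (h4 (f x) (hpos x)) (hφ0 x)) hA
    nlinarith

lemma hasDerivAt_max_pow (k : ℕ) (x : ℝ) :
    HasDerivAt (fun x : ℝ => (max x 0) ^ (k + 2)) ((k + 2) * (max x 0) ^ (k + 1)) x := by
  rcases lt_trichotomy x 0 with h | h | h
  · have : (fun x : ℝ => (max x 0) ^ (k + 2)) =ᶠ[nhds x] fun _ => 0 := by
      filter_upwards [Iio_mem_nhds h] with y hy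
      rw [max_eq_right (le_of_lt hy)]; simp
    rw [max_eq_right h.le]
    simpa using (hasDerivAt_const x (0:ℝ)).congr_of_eventuallyEq this
  · subst h
    rw [max_self, zero_pow (by omega), mul_zero]
    rw [hasDerivAt_iff_isLittleO]
    simp only [max_self, zero_pow (show k + 2 ≠ 0 by omega), sub_zero, smul_zero]
    have h1 : (fun x : ℝ => (max x 0) ^ (k + 2)) =O[nhds 0] fun x => x ^ (k+2) := by
      apply Asymptotics.IsBigO.of_bound 1
      filter_upwards with y
      rw [norm_pow, norm_pow, one_mul]
      gcongr
      rw [Real.norm_eq_abs, Real.norm_eq_abs, abs_of_nonneg (le_max_right _ _)]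
      exact max_le (le_abs_self _) (abs_nonneg _)
    refine h1.trans_isLittleO ?_
    simpa using Asymptotics.isLittleO_pow_pow (𝕜 := ℝ) (show 1 < k + 2 by omega)
  · have : (fun x : ℝ => (max x 0) ^ (k + 2)) =ᶠ[nhds x] fun x => x ^ (k+2) := by
      filter_upwards [Ioi_mem_nhds h] with y hy
      rw [max_eq_left (le_of_lt hy)]
    rw [max_eq_left h.le]
    have h2 := (hasDerivAt_pow (k+2) x).congr_of_eventuallyEq this
    simpa using h2

lemma phi_ex : ∃ Φ Φ1 Φ2 : ℝ → ℝ, (∀ s, 0 < s → HasDerivAt Φ (Φ1 s) s) ∧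
    (∀ s, 0 < s → HasDerivAt Φ1 (Φ2 s) s) ∧ ContinuousOn Φ2 (Set.Ioi 0) ∧
    (∀ s, 0 < s → Φ1 s ^ 2 ≤ Φ2 s) ∧ (∀ s, 0 < s → 0 ≤ Φ s) ∧ (∀ s, 1 ≤ s → Φ s = 0) ∧
    (∀ s D, 0 < s → Φ s ≤ D → Real.exp (-D) / 3 ≤ s) := by
  let m : ℝ → ℝ := fun s => max (1 - s) 0
  have hm0 : ∀ s, 0 ≤ m s := fun s => le_max_right _ _
  have hm1 : ∀ s, 0 < s → m s < 1 := fun s hs => max_lt (by linarith) one_pos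
  let P : ℝ → ℝ := fun s => 1 - m s ^ 3
  have hP : ∀ s, 0 < s → 0 < P s := by
    intro s hs
    have : m s ^ 3 < 1 := pow_lt_one₀ (hm0 s) (hm1 s hs) (by norm_num)
    simp only [P]; linarith
  have dm : ∀ (k : ℕ) s, HasDerivAt (fun s => m s ^ (k + 2)) (-((k + 2) * m s ^ (k + 1))) s := by
    intro k s
    have := (hasDerivAt_max_pow k (1 - s)).comp s ((hasDerivAt_id s).const_sub 1)
    exact this.congr_deriv (by simp [m])
  have dP : ∀ s, HasDerivAt P (3 * m s ^ 2) s := by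
    intro s
    have := (dm 1 s).const_sub 1
    exact this.congr_deriv (by norm_num)
  have dm2 : ∀ s, HasDerivAt (fun s => -(3 * m s ^ 2)) (6 * m s) s := by
    intro s
    have := ((dm 0 s).const_mul 3).neg
    exact this.congr_deriv (by norm_num; ring)
  have cm : Continuous m := by fun_prop
  have cP : Continuous P := by fun_prop
  refine ⟨fun s => -Real.log (P s), fun s => -(3 * m s ^ 2) / P s,
    fun s => (6 * m s * P s - -(3 * m s ^ 2) * (3 * m s ^ 2)) / P s ^ 2, ?_, ?_, ?_, ?_, ?_, ?_, ?_⟩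
  · intro s hs
    have := ((dP s).log (hP s hs).ne').neg
    exact this.congr_deriv (by ring)
  · intro s hs
    exact (dm2 s).div (dP s) (hP s hs).ne'
  · apply ContinuousOn.div (by fun_prop) (by fun_prop)
    intro s hs
    exact pow_ne_zero _ (hP s hs).ne'
  · intro s hs
    have := hP s hs
    beta_reduce
    rw [div_pow]
    apply div_le_div_of_nonneg_right _ (by positivity)
    nlinarith [mul_nonneg (hm0 s) this.le]
  · intro s hs
    have : P s ≤ 1 := by simp only [P]; linarith [pow_nonneg (hm0 s) 3]
    have := Real.log_nonpos (hP s hs).le this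
    linarith
  · intro s hs
    have : m s = 0 := max_eq_right (by linarith)
    simp [P, this]
  · intro s D hs h
    have h1 : Real.exp (-D) ≤ P s := by
      rw [← Real.le_log_iff_exp_le (hP s hs)]; linarith
    have h2 : P s ≤ 3 * s := by
      rcases le_total 1 s with h | h
      · have : m s = 0 := max_eq_right (by linarith)
        simp [P, this]; linarith
      · have : m s = 1 - s := max_eq_left (by linarith)
        simp only [P, this]
        nlinarith [mul_nonneg hs.le hs.le, sq_nonneg s]
    linarith

end

section
set_option maxSynthPendingDepth 3

set_option maxHeartbeats 1000000 in
lemma moser_step (n : ℕ) (hn : 1 ≤ n) (lam Lam : ℝ) : ∃ κ : ℝ, 1 < κ ∧ κ ≤ 2 ∧ ∃ C : ℝ, 1 ≤ C ∧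
    ∀ (a : En n → (En n →L[ℝ] ℝ) →L[ℝ] (En n →L[ℝ] ℝ) →L[ℝ] ℝ) (_ : Ell n a lam Lam)
      (w : En n → ℝ) (_ : ContDiff ℝ 1 w) (_ : ∀ x, 1 ≤ w x) (_ : LogSub n a w)
      (r s p : ℝ), 0 < r → r < s → s ≤ 1 → 1 ≤ p →
      ∫ x in closedBall (0 : En n) r, w x ^ (p * κ) ≤
        (C * p / (s - r) ^ 2 * ∫ x in closedBall (0 : En n) s, w x ^ p) ^ κ := by
  obtain ⟨κ, hκ1, hκ2, C, hC1, hC⟩ := sobolev_ex n hn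
  obtain ⟨K, hK1, hK⟩ := cutoff_ex n
  have hCe : 0 ≤ 4 * Lam ^ 2 / lam ^ 2 := by positivity
  set Ce := 4 * Lam ^ 2 / lam ^ 2 with hCe_def
  have hK2 : 1 ≤ K ^ 2 := by nlinarith
  refine ⟨κ, hκ1, hκ2, C * ((2 + Ce) * (2 * K ^ 2)), ?_, ?_⟩
  · have : 1 ≤ (2 + Ce) * (2 * K ^ 2) := by nlinarith
    nlinarith
  intro a ha w hw hw1 hs r s p hr hrs hs1 hp
  obtain ⟨η, η1, η2, η3, η4, -, η6, η7, η8⟩ := hK r s hr hrs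
  have hwpos : ∀ x, 0 < w x := fun x => lt_of_lt_of_le one_pos (hw1 x)
  have cDw : Continuous (fderiv ℝ w) := hw.continuous_fderiv one_ne_zero
  have cDη : Continuous (fderiv ℝ η) := η1.continuous_fderiv one_ne_zero
  have hpw : ∀ q : ℝ, ContDiff ℝ 1 (fun x => w x ^ q) := fun q =>
    hw.rpow_const_of_ne (fun x => (hwpos x).ne')
  let u : En n → ℝ := fun x => η x ^ 2 * w x ^ p
  have hu : ContDiff ℝ 1 u := (η1.pow 2).mul (hpw p)
  have hu0 : ∀ x, x ∉ tsupport η → u x = 0 := by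
    intro x hx
    simp [u, image_eq_zero_of_notMem_tsupport hx]
  have huts : tsupport u ⊆ tsupport η := by
    apply closure_minimal _ (isClosed_tsupport _)
    intro x hx
    by_contra h
    exact hx (hu0 x h)
  have huc : HasCompactSupport u := HasCompactSupport.intro η7 hu0
  have hD : ∀ x, fderiv ℝ u x = (2 * η x * w x ^ p) • fderiv ℝ η x +
      (η x ^ 2 * (p * w x ^ (p - 1))) • fderiv ℝ w x := by
    intro x
    have h1 : HasFDerivAt η (fderiv ℝ η x) x := (η1.differentiable one_ne_zero x).hasFDerivAt
    have h2 : HasFDerivAt w (fderiv ℝ w x) x := (hw.differentiable one_ne_zero x).hasFDerivAt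
    have h3 := (h1.pow 2).mul (h2.rpow_const (p := p) (Or.inl (hwpos x).ne'))
    have h4 : fderiv ℝ u x = _ := h3.fderiv
    rw [h4]
    ext v
    simp
    ring
  have hsob := hC u hu (huts.trans (η6.trans (closedBall_subset_closedBall (by linarith))))
  have hen := energy ha hw hw1 hs η1 η7 (q := p - 1) (by linarith)
  -- integrability
  have i1 : Integrable (fun x => w x ^ p * η x ^ 2) := by
    apply integrable_off η7
    · exact ((hpw p).continuous).mul (η1.continuous.pow 2)
    · intro x hx; simp [image_eq_zero_of_notMem_tsupport hx]
  have i2 : Integrable (fun x => w x ^ p * ‖fderiv ℝ η x‖ ^ 2) := by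
    apply integrable_off η7
    · exact ((hpw p).continuous).mul (cDη.norm.pow 2)
    · intro x hx; simp [fderiv_off hx]
  have i3 : Integrable (fun x => η x ^ 2 * w x ^ (p - 1) * ‖fderiv ℝ w x‖ ^ 2) := by
    apply integrable_off η7
    · exact ((η1.continuous.pow 2).mul (hpw (p-1)).continuous).mul (cDw.norm.pow 2)
    · intro x hx; simp [image_eq_zero_of_notMem_tsupport hx]
  have i4 : Integrable (fun x => w x ^ (p - 1) * ‖fderiv ℝ η x‖ ^ 2) := by
    apply integrable_off η7
    · exact ((hpw (p-1)).continuous).mul (cDη.norm.pow 2)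
    · intro x hx; simp [fderiv_off hx]
  have i5 : Integrable (fun x => ‖fderiv ℝ u x‖) :=
    ((hu.continuous_fderiv one_ne_zero).integrable_of_hasCompactSupport (huc.fderiv ℝ)).norm
  have hle : ∀ x, w x ^ (p - 1) ≤ w x ^ p := fun x =>
    Real.rpow_le_rpow_of_exponent_le (hw1 x) (by linarith)
  have hW1 : ∀ x, 0 ≤ w x ^ (p - 1) := fun x => Real.rpow_nonneg (hwpos x).le _
  have hW : ∀ x, 0 ≤ w x ^ p := fun x => Real.rpow_nonneg (hwpos x).le _
  have hpt : ∀ x, ‖fderiv ℝ u x‖ ≤ (w x ^ p * η x ^ 2 + w x ^ p * ‖fderiv ℝ η x‖ ^ 2) +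
      p * (w x ^ p * η x ^ 2 + η x ^ 2 * w x ^ (p - 1) * ‖fderiv ℝ w x‖ ^ 2) := by
    intro x
    rw [hD]
    refine (norm_add_le _ _).trans ?_
    rw [norm_smul, norm_smul, Real.norm_of_nonneg (by have := η2 x; have := hW x; positivity),
      Real.norm_of_nonneg (by have := η2 x; have := hW1 x; positivity)]
    have h1 := η2 x
    have h2 := hW x
    have h3 := hW1 x
    have h4 := hle x
    set X := ‖fderiv ℝ w x‖
    set Y := ‖fderiv ℝ η x‖
    have hX : X ≤ 1 + X ^ 2 := by nlinarith [sq_nonneg (X - 1/2)]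
    apply add_le_add
    · have : 0 ≤ w x ^ p * (η x - Y) ^ 2 := by positivity
      nlinarith
    · calc η x ^ 2 * (p * w x ^ (p - 1)) * X ≤ η x ^ 2 * (p * w x ^ (p - 1)) * (1 + X ^ 2) := by gcongr
        _ = p * (η x ^ 2 * w x ^ (p - 1) + η x ^ 2 * w x ^ (p - 1) * X ^ 2) := by ring
        _ ≤ p * (η x ^ 2 * w x ^ p + η x ^ 2 * w x ^ (p - 1) * X ^ 2) := by gcongr
        _ = _ := by ring
  have hIntBd : ∫ x, ‖fderiv ℝ u x‖ ≤ (∫ x, w x ^ p * η x ^ 2) + (∫ x, w x ^ p * ‖fderiv ℝ η x‖ ^ 2) +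
      p * ((∫ x, w x ^ p * η x ^ 2) + ∫ x, η x ^ 2 * w x ^ (p - 1) * ‖fderiv ℝ w x‖ ^ 2) := by
    refine (integral_mono i5 ((i1.add i2).add ((i1.add i3).const_mul p)) hpt).trans (le_of_eq ?_)
    rw [integral_add' (i1.add i2) ((i1.add i3).const_mul p), integral_add' i1 i2, integral_const_mul, integral_add' i1 i3]
  have h4 : ∫ x, w x ^ (p - 1) * ‖fderiv ℝ η x‖ ^ 2 ≤ ∫ x, w x ^ p * ‖fderiv ℝ η x‖ ^ 2 := by
    apply integral_mono i4 i2
    intro x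
    exact mul_le_mul_of_nonneg_right (hle x) (sq_nonneg _)
  have hsr : 0 < s - r := by linarith
  have hsr1 : s - r ≤ 1 := by linarith
  set T := K ^ 2 / (s - r) ^ 2 with hT
  have hT1 : 1 ≤ T := by
    rw [hT, le_div_iff₀ (by positivity)]
    nlinarith
  set I := ∫ x in closedBall (0 : En n) s, w x ^ p with hI
  have iI : IntegrableOn (fun x => w x ^ p) (closedBall (0 : En n) s) :=
    (hpw p).continuous.continuousOn.integrableOn_compact (isCompact_closedBall 0 s)
  have hI0 : 0 ≤ I := setIntegral_nonneg measurableSet_closedBall (fun x _ => hW x)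
  have restr : ∀ F : En n → ℝ, Integrable F → (∀ x, x ∉ tsupport η → F x = 0) → ∀ c : ℝ,
      (∀ x, F x ≤ c * w x ^ p) → ∫ x, F x ≤ c * I := by
    intro F iF hF c hFc
    have : ∫ x, F x = ∫ x in closedBall (0 : En n) s, F x := by
      rw [setIntegral_eq_integral_of_forall_compl_eq_zero]
      intro x hx
      exact hF x (fun h => hx (η6 h))
    rw [this, hI, ← integral_const_mul]
    exact integral_mono iF.integrableOn (iI.const_mul c) hFc
  have j1 : (∫ x, w x ^ p * η x ^ 2) ≤ T * I := by
    apply restr _ i1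
    · intro x hx; simp [image_eq_zero_of_notMem_tsupport hx]
    · intro x
      have : η x ^ 2 ≤ T := by nlinarith [η2 x, η3 x]
      nlinarith [hW x]
  have j2 : (∫ x, w x ^ p * ‖fderiv ℝ η x‖ ^ 2) ≤ T * I := by
    apply restr _ i2
    · intro x hx; simp [fderiv_off hx]
    · intro x
      have : ‖fderiv ℝ η x‖ ^ 2 ≤ T := by
        rw [hT, ← div_pow]
        exact pow_le_pow_left₀ (norm_nonneg _) (η8 x) 2
      nlinarith [hW x]
  have hTI : 0 ≤ T * I := by positivity
  have k1 : ∫ x, ‖fderiv ℝ u x‖ ≤ (2 + Ce) * (2 * K ^ 2) * p / (s - r) ^ 2 * I := by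
    have e1 : (2 + Ce) * (2 * K ^ 2) * p / (s - r) ^ 2 * I = 2 * (2 + Ce) * p * (T * I) := by
      rw [hT]; ring
    rw [e1]
    have e2 : ∫ x, η x ^ 2 * w x ^ (p - 1) * ‖fderiv ℝ w x‖ ^ 2 ≤ Ce * (T * I) := by
      refine hen.trans ?_
      gcongr
      exact h4.trans j2
    have e3 : p * ((∫ x, w x ^ p * η x ^ 2) + ∫ x, η x ^ 2 * w x ^ (p - 1) * ‖fderiv ℝ w x‖ ^ 2) ≤
        p * (T * I + Ce * (T * I)) := by gcongr
    have e4 : T * I ≤ p * (T * I) := by nlinarith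
    have e5 : 0 ≤ p * (Ce * (T * I)) := by positivity
    have e6 : 2 * (2 + Ce) * p * (T * I) = 4 * (p * (T * I)) + 2 * (p * (Ce * (T * I))) := by ring
    have e7 : p * (T * I + Ce * (T * I)) = p * (T * I) + p * (Ce * (T * I)) := by ring
    rw [e6]
    rw [e7] at e3
    linarith
  have hN : 0 ≤ ∫ x, ‖fderiv ℝ u x‖ := integral_nonneg (fun x => norm_nonneg _)
  have iu : Integrable (fun x => |u x| ^ κ) := by
    apply integrable_off η7
    · exact hu.continuous.abs.rpow_const (fun x => Or.inr (by linarith))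
    · intro x hx
      rw [hu0 x hx, abs_zero, Real.zero_rpow (by linarith)]
  have k2 : ∫ x in closedBall (0 : En n) r, w x ^ (p * κ) ≤ ∫ x, |u x| ^ κ := by
    have : ∫ x in closedBall (0 : En n) r, w x ^ (p * κ) = ∫ x in closedBall (0 : En n) r, |u x| ^ κ := by
      apply setIntegral_congr_fun measurableSet_closedBall
      intro x hx
      simp only [u]
      rw [η4 x hx, one_pow, one_mul, abs_of_nonneg (hW x), Real.rpow_mul (hwpos x).le]
    rw [this]
    exact setIntegral_le_integral iu (Filter.Eventually.of_forall fun x => by positivity)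
  calc _ ≤ _ := k2
    _ ≤ _ := hsob
    _ ≤ C ^ κ * (∫ x, ‖fderiv ℝ u x‖) ^ κ := by
        gcongr
        exact Real.self_le_rpow_of_one_le hC1 hκ1.le
    _ ≤ C ^ κ * ((2 + Ce) * (2 * K ^ 2) * p / (s - r) ^ 2 * I) ^ κ := by gcongr
    _ = _ := by
        rw [← Real.mul_rpow (by linarith) (by positivity)]
        congr 1; ring

lemma iter_num (κ C b : ℝ) (hκ : 1 < κ) (hC : 1 ≤ C) (hb : 1 ≤ b) : ∃ D : ℝ, 1 ≤ D ∧
    ∀ I : ℕ → ℝ, (∀ k, 0 ≤ I k) → (∀ k : ℕ, I (k + 1) ≤ (C * b ^ k * I k) ^ κ) →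
      ∀ k : ℕ, I k ≤ (D * I 0) ^ (κ ^ k) := by
  have hκ1 : 0 < κ - 1 := by linarith
  set μ := κ / (κ - 1) with hμ
  set β := μ / (κ - 1) with hβ
  have e1 : κ * μ = μ + κ := by rw [hμ]; field_simp; ring
  have e2 : κ * β = μ + β := by rw [hβ]; field_simp; ring
  have hμ0 : 0 ≤ μ := by positivity
  have hβ0 : 0 ≤ β := by positivity
  have hC0 : 0 < C := by linarith
  have hb0 : 0 < b := by linarith
  refine ⟨C ^ μ * b ^ β, ?_, ?_⟩
  · exact one_le_mul_of_one_le_of_one_le (Real.one_le_rpow hC hμ0) (Real.one_le_rpow hb hβ0)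
  intro I hI hstep
  have key : ∀ k : ℕ, C ^ μ * b ^ (μ * k + β) * I k ≤ (C ^ μ * b ^ β * I 0) ^ (κ ^ k) := by
    intro k
    induction k with
    | zero => simp
    | succ k ih =>
      have h1 : C ^ μ * b ^ (μ * (k + 1 : ℕ) + β) * (C * b ^ k * I k) ^ κ = (C ^ μ * b ^ (μ * k + β) * I k) ^ κ := by
        rw [Real.mul_rpow (by positivity) (hI k), Real.mul_rpow (by positivity) (hI k),
          Real.mul_rpow (by positivity) (by positivity), Real.mul_rpow (by positivity) (by positivity),
          ← Real.rpow_mul hC0.le, ← Real.rpow_mul hb0.le, ← Real.rpow_natCast b k, ← Real.rpow_mul hb0.le]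
        have : C ^ (μ * κ) = C ^ μ * C ^ κ := by
          rw [← Real.rpow_add hC0]; congr 1; linarith
        rw [this]
        have : b ^ ((μ * k + β) * κ) = b ^ (μ * (k + 1 : ℕ) + β) * b ^ (k * κ) := by
          rw [← Real.rpow_add hb0]; congr 1; push_cast; linear_combination (k:ℝ) * e1 + e2
        rw [this]; ring
      calc _ ≤ C ^ μ * b ^ (μ * (k + 1 : ℕ) + β) * (C * b ^ k * I k) ^ κ := by
            gcongr; exact hstep k
        _ = _ := h1
        _ ≤ ((C ^ μ * b ^ β * I 0) ^ (κ ^ k)) ^ κ := by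
            have := hI k
            gcongr
        _ = _ := by
            have := hI 0
            rw [← Real.rpow_mul (by positivity), pow_succ]
  intro k
  refine le_trans ?_ (key k)
  have : 1 ≤ C ^ μ * b ^ (μ * k + β) :=
    one_le_mul_of_one_le_of_one_le (Real.one_le_rpow hC hμ0) (Real.one_le_rpow hb (by positivity))
  nlinarith [hI k]

lemma sup_bound (n : ℕ) (hn : 1 ≤ n) (lam Lam : ℝ) : ∃ D : ℝ, 1 ≤ D ∧
    ∀ (a : En n → (En n →L[ℝ] ℝ) →L[ℝ] (En n →L[ℝ] ℝ) →L[ℝ] ℝ) (_ : Ell n a lam Lam)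
      (w : En n → ℝ) (_ : ContDiff ℝ 1 w) (_ : ∀ x, 1 ≤ w x) (_ : LogSub n a w),
      ∀ x ∈ ball (0 : En n) (1/4), w x ≤ D * ∫ x in ball (0 : En n) 1, w x := by
  obtain ⟨κ, hκ1, hκ2, C, hC1, hC⟩ := moser_step n hn lam Lam
  obtain ⟨D, hD1, hD⟩ := iter_num κ (16 * C) 8 hκ1 (by linarith) (by norm_num)
  refine ⟨D, hD1, ?_⟩
  intro a ha w hw hw1 hs x0 hx0
  have hwpos : ∀ x, 0 < w x := fun x => lt_of_lt_of_le one_pos (hw1 x)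
  have hW : ∀ (q : ℝ) x, 0 ≤ w x ^ q := fun q x => Real.rpow_nonneg (hwpos x).le _
  have hpw : ∀ q : ℝ, Continuous (fun x => w x ^ q) := fun q =>
    (hw.rpow_const_of_ne (fun x => (hwpos x).ne')).continuous
  let ρ : ℕ → ℝ := fun k => 1 / 4 + (1 / 2) ^ (k + 1)
  let I : ℕ → ℝ := fun k => ∫ x in closedBall (0 : En n) (ρ k), w x ^ (κ ^ k)
  have hI : ∀ k, 0 ≤ I k := fun k => setIntegral_nonneg measurableSet_closedBall (fun x _ => hW _ x)
  have hκ0 : (0:ℝ) < κ := by linarith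
  have hstep : ∀ k : ℕ, I (k + 1) ≤ (16 * C * 8 ^ k * I k) ^ κ := by
    intro k
    have hp : (0:ℝ) < (1/2) ^ (k + 1) := by positivity
    have hp1 : ((1:ℝ)/2) ^ (k + 1) ≤ 1 / 2 := by
      rw [pow_succ]
      have : ((1:ℝ)/2) ^ k ≤ 1 := pow_le_one₀ (by norm_num) (by norm_num)
      linarith
    have hdiff : ρ k - ρ (k + 1) = (1 / 2) ^ (k + 2) := by
      simp only [ρ]; ring
    have h1 := hC a ha w hw hw1 hs (ρ (k + 1)) (ρ k) (κ ^ k) (by simp only [ρ]; positivity)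
      (by have : (0:ℝ) < (1 / 2) ^ (k + 2) := by positivity
          linarith) (by simp only [ρ]; linarith) (one_le_pow₀ hκ1.le)
    have h2 : I (k + 1) = ∫ x in closedBall (0 : En n) (ρ (k + 1)), w x ^ (κ ^ k * κ) := by
      simp only [I, pow_succ]
    rw [h2]
    refine h1.trans ?_
    have hIk := hI k
    apply Real.rpow_le_rpow (by positivity) _ hκ0.le
    apply mul_le_mul_of_nonneg_right _ hIk
    rw [hdiff]
    have h3 : C * κ ^ k / ((1 / 2) ^ (k + 2)) ^ 2 = 16 * C * (κ ^ k * 4 ^ k) := by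
      rw [← pow_mul, one_div, inv_pow, div_inv_eq_mul]
      have : (2:ℝ) ^ ((k + 2) * 2) = 16 * 4 ^ k := by
        rw [show (k + 2) * 2 = 2 * k + 4 by ring, pow_add, pow_mul]; norm_num; ring
      rw [this]; ring
    rw [h3, ← mul_pow]
    gcongr
    linarith
  have hfin := hD I hI hstep
  set S := ∫ x in ball (0 : En n) 1, w x with hS
  have hI0 : I 0 ≤ S := by
    have : I 0 = ∫ x in closedBall (0 : En n) (3/4), w x := by
      simp only [I, ρ, pow_zero, Real.rpow_one]
      norm_num
    rw [this]
    apply setIntegral_mono_set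
    · exact (hw.continuous.continuousOn.integrableOn_compact (isCompact_closedBall 0 1)).mono_set ball_subset_closedBall
    · exact Filter.Eventually.of_forall fun x => (hwpos x).le
    · exact (closedBall_subset_ball (by norm_num)).eventuallyLE
  have hDI : 0 ≤ D * I 0 := mul_nonneg (by linarith) (hI 0)
  refine le_trans ?_ (mul_le_mul_of_nonneg_left hI0 (by linarith))
  by_contra hcon
  rw [not_le] at hcon
  obtain ⟨d, hd1, hd2⟩ := exists_between hcon
  have hd0 : 0 < d := lt_of_le_of_lt hDI hd1
  let U : Set (En n) := ball 0 (1/4) ∩ {x | d < w x}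
  have hUo : IsOpen U := isOpen_ball.inter (isOpen_lt continuous_const hw.continuous)
  have hUpos : 0 < volume U := hUo.measure_pos volume ⟨x0, hx0, hd2⟩
  have hUfin : volume U < ⊤ := lt_of_le_of_lt (measure_mono Set.inter_subset_left) measure_ball_lt_top
  set m := (volume U).toReal with hm
  have hm0 : 0 < m := ENNReal.toReal_pos hUpos.ne' hUfin.ne
  have hbound : ∀ k : ℕ, m ≤ ((D * I 0) / d) ^ (κ ^ k) := by
    intro k
    have h1 : m * d ^ (κ ^ k) ≤ I k := by
      calc m * d ^ (κ ^ k) = ∫ x in U, d ^ (κ ^ k) := by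
            rw [setIntegral_const, smul_eq_mul]; rfl
        _ ≤ ∫ x in U, w x ^ (κ ^ k) := by
            apply setIntegral_mono_on
            · exact integrableOn_const hUfin.ne
            · exact ((hpw _).continuousOn.integrableOn_compact (isCompact_closedBall 0 1)).mono_set
                (Set.inter_subset_left.trans (ball_subset_closedBall.trans (closedBall_subset_closedBall (by norm_num))))
            · exact hUo.measurableSet
            · intro x hx
              exact Real.rpow_le_rpow hd0.le (le_of_lt hx.2) (by positivity)
        _ ≤ I k := by
            apply setIntegral_mono_set
            · exact (hpw _).continuousOn.integrableOn_compact (isCompact_closedBall 0 _)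
            · exact Filter.Eventually.of_forall fun x => hW _ x
            · apply HasSubset.Subset.eventuallyLE
              refine Set.inter_subset_left.trans (ball_subset_closedBall.trans (closedBall_subset_closedBall ?_))
              simp only [ρ]
              have : (0:ℝ) < (1/2) ^ (k + 1) := by positivity
              linarith
    rw [Real.div_rpow hDI hd0.le, le_div_iff₀ (by positivity)]
    exact h1.trans (hfin k)
  have ht : Filter.Tendsto (fun k : ℕ => ((D * I 0) / d) ^ (κ ^ k)) Filter.atTop (nhds 0) := by
    have h1 := tendsto_rpow_atTop_of_base_lt_one ((D * I 0) / d)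
      (by have : 0 ≤ (D * I 0) / d := by positivity
          linarith) (by rw [div_lt_one hd0]; exact hd1)
    exact h1.comp (tendsto_pow_atTop_atTop_of_one_lt hκ1)
  have := ge_of_tendsto' ht hbound
  linarith

end

section
set_option maxSynthPendingDepth 3

set_option maxHeartbeats 1000000 in
lemma key_lower (n : ℕ) (hn : 1 ≤ n) (lam Lam : ℝ) : ∃ c : ℝ, 0 < c ∧
    ∀ (a : En n → (En n →L[ℝ] ℝ) →L[ℝ] (En n →L[ℝ] ℝ) →L[ℝ] ℝ) (_ : Ell n a lam Lam)
      (f : En n → ℝ) (_ : ContDiff ℝ 1 f) (_ : ∀ x, 0 < f x) (_ : WeakSol n a f),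
      (volume (ball (0 : En n) 1)).toReal / 2 ≤ (volume (ball (0 : En n) 1 ∩ {x | 1 ≤ f x})).toReal →
      ∀ x ∈ ball (0 : En n) (1/4), c ≤ f x := by
  obtain ⟨D, hD1, hD⟩ := sup_bound n hn lam Lam
  obtain ⟨K, hK1, hK⟩ := cutoff_ex n
  obtain ⟨η, η1, η2, η3, η4, -, η6, η7, η8⟩ := hK 1 2 one_pos (by norm_num)
  obtain ⟨Φ, Φ1, Φ2, p1, p2, p3, p4, p5, p6, p7⟩ := phi_ex
  set B := (volume (ball (0 : En n) 1)).toReal with hB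
  have hB0 : 0 < B := ENNReal.toReal_pos (measure_ball_pos volume 0 one_pos).ne' measure_ball_lt_top.ne
  set Ce := 4 * Lam ^ 2 / lam ^ 2 with hCe
  set J := ∫ x, ‖fderiv ℝ η x‖ ^ 2 with hJ
  set G := B + Ce * J with hG
  set S := 4 * 2 ^ n * G + B with hS
  refine ⟨Real.exp (-(D * S)) / 3, by positivity, ?_⟩
  intro a ha f hf hpos hsol hvol x hx
  have hc1 : ContinuousOn Φ1 (Set.Ioi 0) := fun s hs => (p2 s hs).continuousAt.continuousWithinAt
  obtain ⟨w1, -⟩ := contDiff_comp_one hf hpos p1 hc1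
  have hls := logsub_of_sol ha hf hpos hsol p1 p2 p3 p4
  set w0 : En n → ℝ := fun x => Φ (f x) with hw0
  let w : En n → ℝ := fun x => w0 x + 1
  have hw : ContDiff ℝ 1 w := w1.add contDiff_const
  have hwD : fderiv ℝ w = fderiv ℝ w0 := by
    funext y; exact fderiv_add_const 1
  have hw01 : ∀ x, 0 ≤ w0 x := fun x => p5 _ (hpos x)
  have hw1 : ∀ x, 1 ≤ w x := fun x => by have := hw01 x; simp only [w]; linarith
  have hlw : LogSub n a w := by
    intro φ h1 h2 h3
    rw [hwD]
    exact hls φ h1 h2 h3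
  have hen := energy ha hw hw1 hlw η1 η7 (q := 0) le_rfl
  simp only [Real.rpow_zero, mul_one, one_mul] at hen
  rw [hwD, ← hCe, ← hJ] at hen
  have cD : Continuous (fderiv ℝ w0) := w1.continuous_fderiv one_ne_zero
  have i3 : Integrable (fun x => η x ^ 2 * ‖fderiv ℝ w0 x‖ ^ 2) := by
    apply integrable_off η7
    · exact (η1.continuous.pow 2).mul (cD.norm.pow 2)
    · intro x hx; simp [image_eq_zero_of_notMem_tsupport hx]
  have iOn : ∀ F : En n → ℝ, Continuous F → IntegrableOn F (ball (0 : En n) 1) := fun F hF =>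
    (hF.continuousOn.integrableOn_compact (isCompact_closedBall 0 1)).mono_set ball_subset_closedBall
  have e1 : ∫ x in ball (0 : En n) 1, ‖fderiv ℝ w0 x‖ ^ 2 ≤ Ce * J := by
    refine le_trans ?_ hen
    have : ∫ x in ball (0 : En n) 1, ‖fderiv ℝ w0 x‖ ^ 2 =
        ∫ x in ball (0 : En n) 1, η x ^ 2 * ‖fderiv ℝ w0 x‖ ^ 2 := by
      apply setIntegral_congr_fun measurableSet_ball
      intro x hx
      simp only [η4 x (ball_subset_closedBall hx), one_pow, one_mul]
    rw [this]
    exact setIntegral_le_integral i3 (Filter.Eventually.of_forall fun x => by positivity)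
  have hone : ∫ x in ball (0 : En n) 1, (1:ℝ) = B := by
    rw [setIntegral_const, smul_eq_mul, mul_one]; rfl
  have e2 : ∫ x in ball (0 : En n) 1, ‖fderiv ℝ w0 x‖ ≤ G := by
    calc ∫ x in ball (0 : En n) 1, ‖fderiv ℝ w0 x‖
        ≤ ∫ x in ball (0 : En n) 1, (1 + ‖fderiv ℝ w0 x‖ ^ 2) := by
          apply integral_mono (iOn _ cD.norm) (iOn _ (continuous_const.add (cD.norm.pow 2)))
          intro x
          show ‖fderiv ℝ w0 x‖ ≤ 1 + ‖fderiv ℝ w0 x‖ ^ 2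
          nlinarith [sq_nonneg (‖fderiv ℝ w0 x‖ - 1/2)]
      _ = B + ∫ x in ball (0 : En n) 1, ‖fderiv ℝ w0 x‖ ^ 2 := by
          rw [integral_add (iOn (fun _ => (1:ℝ)) continuous_const)
            (iOn (fun x => ‖fderiv ℝ w0 x‖ ^ 2) (cD.norm.pow 2)), hone]
      _ ≤ G := by linarith
  have hP := poincare n w0 w1 (ball (0 : En n) 1 ∩ {x | 1 ≤ f x})
    (measurableSet_ball.inter (isClosed_le continuous_const hf.continuous).measurableSet)
    Set.inter_subset_left (fun x hx => p6 _ hx.2)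
  have e3 : ∫ x in ball (0 : En n) 1, |w0 x| ≤ 4 * 2 ^ n * G := by
    have hX : 0 ≤ ∫ x in ball (0 : En n) 1, |w0 x| := integral_nonneg fun x => abs_nonneg _
    set X := ∫ x in ball (0 : En n) 1, |w0 x|
    have h1 : B / 2 * X ≤ 2 * (2 ^ n * B) * G :=
      calc _ ≤ _ := mul_le_mul_of_nonneg_right hvol hX
        _ ≤ _ := hP
        _ ≤ _ := by gcongr
    have h2 : B * X ≤ B * (4 * 2 ^ n * G) := by linarith
    exact le_of_mul_le_mul_left h2 hB0
  have e4 : ∫ x in ball (0 : En n) 1, w x ≤ S := by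
    have : ∫ x in ball (0 : En n) 1, w x = (∫ x in ball (0 : En n) 1, |w0 x|) + B := by
      simp only [w]
      rw [integral_add (iOn _ w1.continuous) (iOn _ continuous_const), hone]
      simp only [abs_of_nonneg (hw01 _)]
    rw [this]; linarith
  have e5 := hD a ha w hw hw1 hlw x hx
  apply p7 _ _ (hpos x)
  have e6 : D * ∫ x in ball (0 : En n) 1, w x ≤ D * S := by gcongr
  simp only [w, hw0] at e5 e6 ⊢
  linarith

lemma fderiv_scale {n : ℕ} (f : En n → ℝ) (hf : ContDiff ℝ 1 f) (R : ℝ) (x : En n) :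
    fderiv ℝ (fun y => f (R • y)) x = R • fderiv ℝ f (R • x) := by
  have h1 : HasFDerivAt (fun y : En n => R • y) (R • ContinuousLinearMap.id ℝ (En n)) x :=
    (hasFDerivAt_id x).const_smul R
  have h2 := ((hf.differentiable one_ne_zero (R • x)).hasFDerivAt).comp x h1
  have h3 : fderiv ℝ (fun y => f (R • y)) x = _ := h2.fderiv
  rw [h3]
  ext v
  simp

lemma contDiff_scale {n : ℕ} (f : En n → ℝ) (hf : ContDiff ℝ 1 f) (R : ℝ) :
    ContDiff ℝ 1 (fun y => f (R • y)) :=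
  hf.comp (contDiff_const_smul R)

lemma weakSol_affine {n : ℕ} {a : En n → (En n →L[ℝ] ℝ) →L[ℝ] (En n →L[ℝ] ℝ) →L[ℝ] ℝ}
    {f : En n → ℝ} (hf : ContDiff ℝ 1 f) (hs : WeakSol n a f) (c d : ℝ) :
    WeakSol n a (fun x => c * f x + d) := by
  intro φ hφ hc
  have : ∀ y, fderiv ℝ (fun x => c * f x + d) y = c • fderiv ℝ f y := by
    intro y
    rw [fderiv_add_const]
    exact fderiv_const_mul (hf.differentiable one_ne_zero y) c
  simp only [this, map_smul, _root_.smul_apply, smul_eq_mul]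
  rw [integral_const_mul, hs φ hφ hc, mul_zero]

lemma weakSol_scale {n : ℕ} {a : En n → (En n →L[ℝ] ℝ) →L[ℝ] (En n →L[ℝ] ℝ) →L[ℝ] ℝ}
    {f : En n → ℝ} (hf : ContDiff ℝ 1 f) (hs : WeakSol n a f) (R : ℝ) (hR : 0 < R) :
    WeakSol n (fun y => a (R • y)) (fun x => f (R • x)) := by
  intro φ hφ hc
  let ψ : En n → ℝ := fun y => φ (R⁻¹ • y)
  have hψ : ContDiff ℝ 1 ψ := contDiff_scale φ hφ R⁻¹
  have hψc : HasCompactSupport ψ :=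
    hc.comp_homeomorph (Homeomorph.smulOfNeZero R⁻¹ (inv_ne_zero hR.ne'))
  have h1 := hs ψ hψ hψc
  have h2 : ∀ y, a (R • y) (fderiv ℝ (fun x => f (R • x)) y) (fderiv ℝ φ y) =
      R ^ 2 * (fun z => a z (fderiv ℝ f z) (fderiv ℝ ψ z)) (R • y) := by
    intro y
    have h3 : fderiv ℝ ψ (R • y) = R⁻¹ • fderiv ℝ φ y := by
      have := fderiv_scale φ hφ R⁻¹ (R • y)
      rwa [smul_smul, inv_mul_cancel₀ hR.ne', one_smul] at this
    beta_reduce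
    rw [fderiv_scale f hf, h3]
    simp only [map_smul, _root_.smul_apply, smul_eq_mul]
    field_simp
  simp only [h2]
  rw [integral_const_mul, Measure.integral_comp_smul volume (fun z => a z (fderiv ℝ f z) (fderiv ℝ ψ z)), h1]
  simp

lemma ell_scale {n : ℕ} {a : En n → (En n →L[ℝ] ℝ) →L[ℝ] (En n →L[ℝ] ℝ) →L[ℝ] ℝ} {lam Lam : ℝ}
    (ha : Ell n a lam Lam) (R : ℝ) : Ell n (fun y => a (R • y)) lam Lam where
  lam_pos := ha.lam_pos
  Lam_nonneg := ha.Lam_nonneg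
  cont := ha.cont.comp (continuous_const_smul R)
  lower := fun y => ha.lower _
  upper := fun y => ha.upper _

/-- half-measure on a ball of radius `R` implies lower bound -/
lemma lower_scaled (n : ℕ) (hn : 1 ≤ n) (lam Lam : ℝ) : ∃ c : ℝ, 0 < c ∧
    ∀ (a : En n → (En n →L[ℝ] ℝ) →L[ℝ] (En n →L[ℝ] ℝ) →L[ℝ] ℝ) (_ : Ell n a lam Lam)
      (f : En n → ℝ) (_ : ContDiff ℝ 1 f) (_ : ∀ x, 0 ≤ f x) (_ : WeakSol n a f) (R : ℝ), 0 < R →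
      (volume (ball (0 : En n) 1)).toReal / 2 ≤
        (volume (ball (0 : En n) 1 ∩ {x | 1 ≤ f (R • x)})).toReal →
      ∀ x ∈ ball (0 : En n) (R/4), c ≤ f x := by
  obtain ⟨c, hc, h⟩ := key_lower n hn lam Lam
  refine ⟨c, hc, ?_⟩
  intro a ha f hf hpos hs R hR hvol x hx
  apply le_of_forall_pos_le_add
  intro ε hε
  have hs' := weakSol_affine hf hs 1 ε
  simp only [one_mul] at hs'
  have hf' : ContDiff ℝ 1 (fun x => f x + ε) := hf.add contDiff_const
  have := h (fun y => a (R • y)) (ell_scale ha R) (fun y => f (R • y) + ε)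
    (contDiff_scale _ hf' R) (fun x => by have := hpos (R • x); linarith)
    (weakSol_scale hf' hs' R hR) (hvol.trans ?_) (R⁻¹ • x) ?_
  · rwa [smul_smul, mul_inv_cancel₀ hR.ne', one_smul] at this
  · apply ENNReal.toReal_mono
    · exact (lt_of_le_of_lt (measure_mono Set.inter_subset_left) measure_ball_lt_top).ne
    · apply measure_mono
      intro y hy
      refine ⟨hy.1, ?_⟩
      have := hy.2
      simp only [Set.mem_setOf_eq] at this ⊢
      linarith
  · rw [mem_ball_zero_iff] at hx ⊢
    rw [norm_smul, norm_inv, Real.norm_of_nonneg hR.le, inv_mul_lt_iff₀ hR]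
    linarith

lemma liouville_abs (n : ℕ) (hn : 1 ≤ n) (lam Lam : ℝ)
    (a : En n → (En n →L[ℝ] ℝ) →L[ℝ] (En n →L[ℝ] ℝ) →L[ℝ] ℝ) (ha : Ell n a lam Lam)
    (f : En n → ℝ) (hf : ContDiff ℝ 1 f) (hs : WeakSol n a f) (hb : ∃ C, ∀ x, |f x| ≤ C) :
    ∀ x y, f x = f y := by
  obtain ⟨C, hC⟩ := hb
  by_contra hne
  push Not at hne
  obtain ⟨x0, y0, hxy⟩ := hne
  have bb : BddBelow (Set.range f) := ⟨-C, by rintro _ ⟨x, rfl⟩; exact (abs_le.1 (hC x)).1⟩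
  have ba : BddAbove (Set.range f) := ⟨C, by rintro _ ⟨x, rfl⟩; exact (abs_le.1 (hC x)).2⟩
  set m := ⨅ x, f x with hm
  set S := ⨆ x, f x with hS
  have hm' : ∀ x, m ≤ f x := fun x => ciInf_le bb x
  have hS' : ∀ x, f x ≤ S := fun x => le_ciSup ba x
  have hmS : m < S := by
    rcases lt_or_gt_of_ne hxy with h | h
    · exact lt_of_le_of_lt (hm' x0) (lt_of_lt_of_le h (hS' y0))
    · exact lt_of_le_of_lt (hm' y0) (lt_of_lt_of_le h (hS' x0))
  have hd : 0 < S - m := by linarith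
  set t := 2 / (S - m) with ht
  have ht0 : 0 < t := by positivity
  have htd : t * (S - m) = 2 := by rw [ht]; field_simp
  -- two normalisations
  let f1 : En n → ℝ := fun x => t * f x + (- t * m)
  let f2 : En n → ℝ := fun x => (-t) * f x + (t * S)
  have s1 : WeakSol n a f1 := weakSol_affine hf hs _ _
  have s2 : WeakSol n a f2 := weakSol_affine hf hs _ _
  have c1 : ContDiff ℝ 1 f1 := (contDiff_const.mul hf).add contDiff_const
  have c2 : ContDiff ℝ 1 f2 := (contDiff_const.mul hf).add contDiff_const
  have n1 : ∀ x, 0 ≤ f1 x := fun x => by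
    have := mul_nonneg ht0.le (sub_nonneg.2 (hm' x)); simp only [f1]; linarith
  have n2 : ∀ x, 0 ≤ f2 x := fun x => by
    have := mul_nonneg ht0.le (sub_nonneg.2 (hS' x)); simp only [f2]; linarith
  have hsum : ∀ x, f1 x + f2 x = 2 := fun x => by simp only [f1, f2]; linarith
  obtain ⟨c, hc, hlow⟩ := lower_scaled n hn lam Lam
  have z1 : ∃ x, f1 x < c := by
    obtain ⟨x, hx⟩ := exists_lt_of_ciInf_lt (show ⨅ x, f x < m + c / t by
      have : 0 < c / t := by positivity
      linarith)
    refine ⟨x, ?_⟩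
    have h1 : t * f x < t * (m + c / t) := mul_lt_mul_of_pos_left hx ht0
    have h2 : t * (m + c / t) = t * m + c := by field_simp
    simp only [f1]; linarith
  have z2 : ∃ x, f2 x < c := by
    obtain ⟨x, hx⟩ := exists_lt_of_lt_ciSup (show S - c / t < ⨆ x, f x by
      have : 0 < c / t := by positivity
      linarith)
    refine ⟨x, ?_⟩
    have h1 : t * (S - c / t) < t * f x := mul_lt_mul_of_pos_left hx ht0
    have h2 : t * (S - c / t) = t * S - c := by field_simp
    simp only [f2]; linarith
  obtain ⟨x1, hx1⟩ := z1
  obtain ⟨x2, hx2⟩ := z2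
  set R := 4 * (‖x1‖ + ‖x2‖ + 1) with hR
  have hR0 : 0 < R := by positivity
  have b1 : x1 ∈ ball (0 : En n) (R / 4) := by
    rw [mem_ball_zero_iff, hR]; linarith [norm_nonneg x1, norm_nonneg x2]
  have b2 : x2 ∈ ball (0 : En n) (R / 4) := by
    rw [mem_ball_zero_iff, hR]; linarith [norm_nonneg x1, norm_nonneg x2]
  by_cases h1 : (volume (ball (0 : En n) 1)).toReal / 2 ≤
        (volume (ball (0 : En n) 1 ∩ {x | 1 ≤ f1 (R • x)})).toReal
  · exact absurd (hlow a ha f1 c1 n1 s1 R hR0 h1 x1 b1) (not_le.2 hx1)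
  by_cases h2 : (volume (ball (0 : En n) 1)).toReal / 2 ≤
        (volume (ball (0 : En n) 1 ∩ {x | 1 ≤ f2 (R • x)})).toReal
  · exact absurd (hlow a ha f2 c2 n2 s2 R hR0 h2 x2 b2) (not_le.2 hx2)
  have hfin : ∀ s, volume (ball (0 : En n) 1 ∩ s) ≠ ⊤ := fun s =>
    (lt_of_le_of_lt (measure_mono Set.inter_subset_left) measure_ball_lt_top).ne
  have hle : (volume (ball (0 : En n) 1)).toReal ≤
      (volume (ball (0 : En n) 1 ∩ {x | 1 ≤ f1 (R • x)})).toReal +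
      (volume (ball (0 : En n) 1 ∩ {x | 1 ≤ f2 (R • x)})).toReal := by
    rw [← ENNReal.toReal_add (hfin _) (hfin _)]
    apply ENNReal.toReal_mono (ENNReal.add_ne_top.2 ⟨hfin _, hfin _⟩)
    refine le_trans (measure_mono ?_) (measure_union_le _ _)
    intro y hy
    rcases le_total 1 (f1 (R • y)) with h | h
    · exact Or.inl ⟨hy, h⟩
    · exact Or.inr ⟨hy, by have := hsum (R • y); simp only [Set.mem_setOf_eq]; linarith⟩
  linarith

end

/-- algebraic ellipticity estimate -/
lemma op_ell {E : Type*} [NormedAddCommGroup E] [InnerProductSpace ℝ E] (H : E →ₗ[ℝ] E) (m : ℝ)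
    (hm : 1 ≤ m) (hsym : ∀ x y, inner ℝ (H x) y = inner ℝ x (H y))
    (hpos : ∀ x, ‖x‖ ^ 2 ≤ inner ℝ (H x + m • x) x) (v q : E)
    (hq : H v + m • v = q + H (H q)) :
    ‖v‖ ^ 2 ≤ 2 * (1 + m) ^ 2 * inner ℝ v (H q + m • q) ∧
      ‖H q + m • q‖ ≤ 2 * (1 + m) ^ 2 * ‖v‖ := by
  have hE : inner ℝ v (H q + m • q) = ‖q‖ ^ 2 + ‖H q‖ ^ 2 := by
    have h1 : inner ℝ v (H q + m • q) = inner ℝ (H v + m • v) q := by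
      rw [inner_add_right, inner_add_left, hsym, inner_smul_right, real_inner_smul_left]
    rw [h1, hq, inner_add_left, hsym, real_inner_self_eq_norm_sq, real_inner_self_eq_norm_sq]
  have hlow : ∀ x, ‖x‖ ≤ ‖H x + m • x‖ := by
    intro x
    rcases (norm_nonneg x).eq_or_lt with h | h
    · rw [← h]; exact norm_nonneg _
    · have h1 := (hpos x).trans (real_inner_le_norm _ _)
      rw [sq] at h1
      exact le_of_mul_le_mul_right h1 h
  have hK : H (v - H q) + m • (v - H q) = q - m • H q := by
    rw [map_sub, smul_sub]
    have : H v - H (H q) + (m • v - m • H q) = (H v + m • v) - H (H q) - m • H q := by abel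
    rw [this, hq]; abel
  have h1 : ‖v - H q‖ ≤ ‖q‖ + m * ‖H q‖ := by
    refine (hlow _).trans ?_
    rw [hK]
    refine (norm_sub_le _ _).trans ?_
    rw [norm_smul, Real.norm_of_nonneg (by linarith)]
  have h2 : ‖v‖ ≤ ‖q‖ + m * ‖H q‖ + ‖H q‖ := by
    have : v = (v - H q) + H q := by abel
    rw [this]
    exact (norm_add_le _ _).trans (by linarith)
  have hKq : ‖H q + m • q‖ ≤ ‖H q‖ + m * ‖q‖ := by
    refine (norm_add_le _ _).trans ?_
    rw [norm_smul, Real.norm_of_nonneg (by linarith)]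
  have hin := real_inner_le_norm v (H q + m • q)
  have a0 := norm_nonneg q
  have b0 := norm_nonneg (H q)
  have k0 := norm_nonneg (H q + m • q)
  have v0 := norm_nonneg v
  rw [hE] at hin ⊢
  generalize ‖q‖ = a at *
  generalize ‖H q‖ = b at *
  generalize ‖H q + m • q‖ = k at *
  generalize ‖v‖ = w at *
  have hs : ((1 + m) * (a + b)) ^ 2 ≤ 2 * (1 + m) ^ 2 * (a ^ 2 + b ^ 2) := by
    have : (a + b) ^ 2 ≤ 2 * (a ^ 2 + b ^ 2) := by nlinarith [sq_nonneg (a - b)]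
    nlinarith [sq_nonneg (1 + m)]
  have hma : 0 ≤ m * a := by positivity
  have hmb : 0 ≤ m * b := by positivity
  constructor
  · refine le_trans ?_ hs
    exact pow_le_pow_left₀ v0 (by linarith) 2
  · rcases k0.eq_or_lt with h | h
    · rw [← h]; positivity
    · have h3 : k ^ 2 ≤ ((1 + m) * (a + b)) ^ 2 := pow_le_pow_left₀ k0 (by linarith) 2
      have h4 : k * k ≤ (2 * (1 + m) ^ 2 * w) * k := by
        have : 2 * (1 + m) ^ 2 * (a ^ 2 + b ^ 2) ≤ 2 * (1 + m) ^ 2 * (w * k) := by gcongr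
        linarith
      exact le_of_mul_le_mul_right h4 h

lemma global_inv {n : ℕ} (F : En n → En n) (hF : ContDiff ℝ 1 F)
    (hpos : ∀ x v, ‖v‖ ^ 2 ≤ inner ℝ (fderiv ℝ F x v) v) :
    ∃ e : En n ≃ₜ En n, ⇑e = F ∧ ContDiff ℝ 1 e.symm := by
  have hinj : ∀ x, Function.Injective (fderiv ℝ F x : En n →ₗ[ℝ] En n) := by
    intro x
    rw [← LinearMap.ker_eq_bot, LinearMap.ker_eq_bot']
    intro v hv
    have := hpos x v
    have hv' : fderiv ℝ F x v = 0 := hv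
    rw [hv', inner_zero_left] at this
    have : ‖v‖ ^ 2 = 0 := le_antisymm this (by positivity)
    simpa using this
  let D : En n → (En n ≃L[ℝ] En n) := fun x =>
    (LinearEquiv.ofInjectiveEndo _ (hinj x)).toContinuousLinearEquiv
  have hD : ∀ x, (D x : En n →L[ℝ] En n) = fderiv ℝ F x := by
    intro x; ext1 v; rfl
  have hderiv : ∀ x, HasFDerivAt F (D x : En n →L[ℝ] En n) x := by
    intro x; rw [hD]; exact (hF.differentiable one_ne_zero x).hasFDerivAt
  have hstrict : ∀ x, HasStrictFDerivAt F (D x : En n →L[ℝ] En n) x := by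
    intro x
    exact hF.contDiffAt.hasStrictFDerivAt' (hderiv x) one_ne_zero
  have hopen : IsOpenMap F := by
    rw [isOpenMap_iff_nhds_le]
    intro x
    exact ((hstrict x).map_nhds_eq_of_equiv).ge
  have hmono : ∀ x y, ‖x - y‖ ^ 2 ≤ inner ℝ (F x - F y) (x - y) := by
    intro x y
    set v := x - y with hv
    let p : ℝ → ℝ := fun t => inner ℝ (F (y + t • v)) v - t * ‖v‖ ^ 2
    have hp : ∀ t, HasDerivAt p (inner ℝ (fderiv ℝ F (y + t • v) v) v - ‖v‖ ^ 2) t := by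
      intro t
      have h1 : HasDerivAt (fun t : ℝ => y + t • v) v t := by
        simpa using ((hasDerivAt_id t).smul_const v).const_add y
      have h2 := (hF.differentiable one_ne_zero (y + t • v)).hasFDerivAt.comp_hasDerivAt t h1
      have h3 := (h2.inner ℝ (hasDerivAt_const t v)).sub ((hasDerivAt_id t).mul_const (‖v‖ ^ 2))
      refine h3.congr_deriv ?_
      simp
    have hmon : Monotone p := by
      apply monotone_of_deriv_nonneg (fun t => (hp t).differentiableAt)
      intro t
      rw [(hp t).deriv]
      linarith [hpos (y + t • v) v]
    have h01 := hmon (zero_le_one)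
    simp only [p, zero_smul, add_zero, one_smul, zero_mul, one_mul, sub_zero] at h01
    have hx : y + v = x := by rw [hv]; abel
    rw [hx] at h01
    rw [inner_sub_left]
    linarith
  have hanti : AntilipschitzWith 1 F := by
    apply AntilipschitzWith.of_le_mul_dist
    intro x y
    rw [NNReal.coe_one, one_mul, dist_eq_norm, dist_eq_norm]
    rcases (norm_nonneg (x - y)).eq_or_lt with h | h
    · rw [← h]; exact norm_nonneg _
    · have h1 := (hmono x y).trans (real_inner_le_norm _ _)
      rw [sq] at h1
      exact le_of_mul_le_mul_right h1 h
  have hclosed : IsClosedMap F := by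
    have : IsProperMap F := by
      rw [isProperMap_iff_tendsto_cocompact]
      refine ⟨hF.continuous, ?_⟩
      rw [← Metric.cobounded_eq_cocompact]
      exact hanti.tendsto_cobounded
    exact this.isClosedMap
  have hsurj : Function.Surjective F := by
    have : IsClopen (Set.range F) := ⟨hclosed.isClosed_range, hopen.isOpen_range⟩
    have := this.eq_univ (Set.range_nonempty F)
    exact Set.range_eq_univ.1 this
  let e := (Equiv.ofBijective F ⟨hanti.injective, hsurj⟩).toHomeomorphOfContinuousOpen hF.continuous hopen
  refine ⟨e, rfl, ?_⟩
  exact e.contDiff_symm (f₀' := D) hderiv hF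

lemma det_bounds {n : ℕ} (H : Matrix (Fin n) (Fin n) ℝ) (M : ℝ) (hM : 0 ≤ M)
    (hH : H.IsHermitian)
    (hpos : (H + M • (1 : Matrix (Fin n) (Fin n) ℝ)).PosSemidef) :
    0 < (1 + H * H).det ∧ 1 ≤ (H + (M + 1) • (1 : Matrix (Fin n) (Fin n) ℝ)).det ∧
      (1 + H * H).det ≤ (3 + 2 * (M + 1) ^ 2) ^ n * (H + (M + 1) • (1 : Matrix (Fin n) (Fin n) ℝ)).det ^ 2 ∧
      (H + (M + 1) • (1 : Matrix (Fin n) (Fin n) ℝ)).det ^ 2 ≤ (2 + 2 * (M + 1) ^ 2) ^ n * (1 + H * H).det := by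
  set h := hH.eigenvalues with hh
  have hk : ∀ i, 1 ≤ h i + (M + 1) := by
    intro i
    have h1 := hpos.dotProduct_mulVec_nonneg (hH.eigenvectorBasis i)
    rw [add_mulVec, hH.mulVec_eigenvectorBasis i, smul_mulVec, one_mulVec, ← add_smul, dotProduct_smul] at h1
    have h2 : (0:ℝ) < star (hH.eigenvectorBasis i : Fin n → ℝ) ⬝ᵥ (hH.eigenvectorBasis i : Fin n → ℝ) := by
      rw [dotProduct_star_self_pos_iff]
      intro h0
      exact hH.eigenvectorBasis.orthonormal.ne_zero i (by ext j; exact congrFun h0 j)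
    have h3 : 0 ≤ h i + M := nonneg_of_mul_nonneg_left (by simpa using h1) h2
    linarith
  have hdet : ∀ A : Matrix (Fin n) (Fin n) ℝ,
      (Unitary.conjStarAlgAut ℝ (Matrix (Fin n) (Fin n) ℝ) hH.eigenvectorUnitary A).det = A.det := by
    intro A
    rw [Unitary.conjStarAlgAut_apply, det_mul, det_mul, mul_comm, ← mul_assoc, ← det_mul]
    simp
  have hsp := hH.spectral_theorem
  have hD : (RCLike.ofReal ∘ hH.eigenvalues : Fin n → ℝ) = h := by ext i; rfl
  rw [hD] at hsp
  have d1 : (1 + H * H).det = ∏ i, (1 + h i ^ 2) := by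
    have : 1 + H * H = Unitary.conjStarAlgAut ℝ (Matrix (Fin n) (Fin n) ℝ) hH.eigenvectorUnitary
        (1 + diagonal h * diagonal h) := by
      rw [map_add, map_mul, map_one, ← hsp]
    rw [this, hdet, diagonal_mul_diagonal, ← diagonal_one, diagonal_add, det_diagonal]
    simp [sq]
  have d2 : (H + (M + 1) • (1 : Matrix (Fin n) (Fin n) ℝ)).det = ∏ i, (h i + (M + 1)) := by
    have : H + (M + 1) • (1 : Matrix (Fin n) (Fin n) ℝ) =
        Unitary.conjStarAlgAut ℝ (Matrix (Fin n) (Fin n) ℝ) hH.eigenvectorUnitary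
        (diagonal h + (M + 1) • (1 : Matrix (Fin n) (Fin n) ℝ)) := by
      rw [map_add, map_smul, map_one, ← hsp]
    rw [this, hdet, smul_one_eq_diagonal, diagonal_add, det_diagonal]
  rw [d1, d2]
  refine ⟨Finset.prod_pos fun i _ => by positivity, ?_, ?_, ?_⟩
  · have := Finset.prod_le_prod (s := Finset.univ) (f := fun _ : Fin n => (1:ℝ))
      (g := fun i => h i + (M + 1)) (fun i _ => zero_le_one) (fun i _ => hk i)
    simpa using this
  · rw [← Finset.prod_pow]
    have : (3 + 2 * (M + 1) ^ 2) ^ n = ∏ _i : Fin n, (3 + 2 * (M + 1) ^ 2) := by simp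
    rw [this, ← Finset.prod_mul_distrib]
    apply Finset.prod_le_prod (fun i _ => by positivity)
    intro i _
    have := hk i
    have h2 : 1 ≤ (h i + (M + 1)) ^ 2 := one_le_pow₀ this
    nlinarith [sq_nonneg (h i + 2 * (M + 1)), sq_nonneg (M + 1)]
  · rw [← Finset.prod_pow]
    have : (2 + 2 * (M + 1) ^ 2) ^ n = ∏ _i : Fin n, (2 + 2 * (M + 1) ^ 2) := by simp
    rw [this, ← Finset.prod_mul_distrib]
    apply Finset.prod_le_prod (fun i _ => by positivity)
    intro i _
    nlinarith [sq_nonneg (h i - (M + 1)), sq_nonneg (h i * (M + 1))]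

/-- the matrix of the transformed equation -/
def Amat {n : ℕ} (H : Matrix (Fin n) (Fin n) ℝ) (m : ℝ) : Matrix (Fin n) (Fin n) ℝ :=
  (Real.sqrt (1 + H * H).det / |(H + m • (1 : Matrix (Fin n) (Fin n) ℝ)).det|) •
    ((H + m • (1 : Matrix (Fin n) (Fin n) ℝ)) * (1 + H * H)⁻¹ * (H + m • (1 : Matrix (Fin n) (Fin n) ℝ)))

lemma inner_eq_dot {n : ℕ} (v w : En n) : inner ℝ v w = (v : Fin n → ℝ) ⬝ᵥ (w : Fin n → ℝ) := by
  rw [EuclideanSpace.inner_eq_star_dotProduct, dotProduct_comm]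
  rfl

lemma mat_ell {n : ℕ} (M : ℝ) (hM : 0 ≤ M) : ∃ lam Lam : ℝ, 0 < lam ∧ 0 ≤ Lam ∧
    ∀ H : Matrix (Fin n) (Fin n) ℝ, H.IsHermitian →
      (H + M • (1 : Matrix (Fin n) (Fin n) ℝ)).PosSemidef →
      (∀ v : En n, lam * ‖v‖ ^ 2 ≤ (v : Fin n → ℝ) ⬝ᵥ (Amat H (M + 1) *ᵥ (v : Fin n → ℝ))) ∧
      (∀ v w : En n, |(v : Fin n → ℝ) ⬝ᵥ (Amat H (M + 1) *ᵥ (w : Fin n → ℝ))| ≤ Lam * ‖v‖ * ‖w‖) := by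
  set C1 := (3 + 2 * (M + 1) ^ 2) ^ n with hC1
  set C2 := (2 + 2 * (M + 1) ^ 2) ^ n with hC2
  have hC1p : 0 < C1 := by positivity
  have hC2p : 0 < C2 := by positivity
  set B := 2 * (1 + (M + 1)) ^ 2 with hB
  have hBp : 0 < B := by positivity
  refine ⟨(1 / √C2) / B, √C1 * B, by positivity, by positivity, ?_⟩
  intro H hH hpos
  obtain ⟨g0, k1, gk, kg⟩ := det_bounds H M hM hH hpos
  set m := M + 1 with hm
  set K := H + m • (1 : Matrix (Fin n) (Fin n) ℝ) with hK
  set g := 1 + H * H with hg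
  set ρ := √g.det / |K.det| with hρ
  have hk0 : 0 < K.det := by linarith
  have hρ1 : ρ ≤ √C1 := by
    rw [hρ, abs_of_pos hk0, div_le_iff₀ hk0]
    calc √g.det ≤ √(C1 * K.det ^ 2) := Real.sqrt_le_sqrt gk
      _ = √C1 * K.det := by rw [Real.sqrt_mul hC1p.le, Real.sqrt_sq hk0.le]
  have hρ2 : 1 / √C2 ≤ ρ := by
    rw [hρ, abs_of_pos hk0, div_le_div_iff₀ (by positivity) hk0, one_mul]
    calc K.det = √(K.det ^ 2) := (Real.sqrt_sq hk0.le).symm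
      _ ≤ √(C2 * g.det) := Real.sqrt_le_sqrt kg
      _ = √g.det * √C2 := by rw [Real.sqrt_mul hC2p.le, mul_comm]
  have hρ0 : 0 ≤ ρ := le_trans (by positivity) hρ2
  let T : En n →ₗ[ℝ] En n := Matrix.toEuclideanLin H
  have hT : ∀ v : En n, (T v : Fin n → ℝ) = H *ᵥ (v : Fin n → ℝ) := fun v => rfl
  have hHt : Hᵀ = H := by
    rw [← conjTranspose_eq_transpose_of_trivial]; exact hH
  have hsym : ∀ x y, inner ℝ (T x) y = inner ℝ x (T y) := by
    intro x y
    rw [inner_eq_dot, inner_eq_dot, hT, hT, dotProduct_mulVec, ← mulVec_transpose, hHt]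
  have hKv : ∀ v : En n, ((T v + m • v : En n) : Fin n → ℝ) = K *ᵥ (v : Fin n → ℝ) := by
    intro v
    rw [hK, add_mulVec, smul_mulVec, one_mulVec]
    rfl
  have hpos' : ∀ x, ‖x‖ ^ 2 ≤ inner ℝ (T x + m • x) x := by
    intro x
    have h1 := hpos.dotProduct_mulVec_nonneg (x : Fin n → ℝ)
    have h2 : K *ᵥ (x : Fin n → ℝ) = (H + M • (1 : Matrix (Fin n) (Fin n) ℝ)) *ᵥ (x : Fin n → ℝ) + (x : Fin n → ℝ) := by
      rw [hK, hm, add_smul, one_smul, ← add_assoc, add_mulVec (H + M • 1), one_mulVec]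
    rw [real_inner_comm, inner_eq_dot, hKv, h2, dotProduct_add, ← real_inner_self_eq_norm_sq, inner_eq_dot]
    simp only [star_trivial] at h1
    linarith
  have hgu : IsUnit g.det := g0.ne'.isUnit
  -- solve for q
  have hq : ∀ w : En n, ∃ q : En n, T w + m • w = q + T (T q) ∧
      ∀ v : En n, (v : Fin n → ℝ) ⬝ᵥ (Amat H m *ᵥ (w : Fin n → ℝ)) = ρ * inner ℝ v (T q + m • q) := by
    intro w
    refine ⟨WithLp.toLp 2 (g⁻¹ *ᵥ (K *ᵥ (w : Fin n → ℝ))), ?_, ?_⟩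
    · apply (WithLp.ofLp_injective 2)
      rw [hKv, WithLp.ofLp_add, hT, hT]
      have : g *ᵥ (g⁻¹ *ᵥ (K *ᵥ (w : Fin n → ℝ))) = K *ᵥ (w : Fin n → ℝ) := by
        rw [mulVec_mulVec, mul_nonsing_inv _ hgu, one_mulVec]
      conv_lhs => rw [← this, hg, add_mulVec, one_mulVec, ← mulVec_mulVec]
    · intro v
      rw [inner_eq_dot, hKv]
      simp only [Amat]
      rw [smul_mulVec, dotProduct_smul, smul_eq_mul, ← mulVec_mulVec, ← mulVec_mulVec]
  have hm1 : 1 ≤ m := by rw [hm]; linarith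
  constructor
  · intro v
    obtain ⟨q, hq1, hq2⟩ := hq v
    obtain ⟨r1, -⟩ := op_ell T m hm1 hsym hpos' v q hq1
    rw [hq2 v]
    have hi : ‖v‖ ^ 2 / B ≤ inner ℝ v (T q + m • q) := by
      rw [div_le_iff₀ hBp, mul_comm]; exact r1
    calc 1 / √C2 / B * ‖v‖ ^ 2 = 1 / √C2 * (‖v‖ ^ 2 / B) := by ring
      _ ≤ ρ * (‖v‖ ^ 2 / B) := by gcongr
      _ ≤ _ := by gcongr
  · intro v w
    obtain ⟨q, hq1, hq2⟩ := hq w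
    obtain ⟨-, r2⟩ := op_ell T m hm1 hsym hpos' w q hq1
    rw [hq2 v, abs_mul, abs_of_nonneg hρ0]
    calc ρ * |inner ℝ v (T q + m • q)| ≤ √C1 * (‖v‖ * (B * ‖w‖)) := by
          apply mul_le_mul hρ1 _ (abs_nonneg _) (by positivity)
          exact (abs_real_inner_le_norm _ _).trans (by gcongr)
      _ = _ := by ring

lemma contDiff_det {n : ℕ} {k : WithTop ℕ∞} {g : En n → Matrix (Fin n) (Fin n) ℝ}
    (hg : ∀ i j, ContDiff ℝ k (fun x => g x i j)) : ContDiff ℝ k (fun x => (g x).det) := by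
  simp only [det_apply]
  apply ContDiff.sum
  intro σ _
  apply ContDiff.const_smul
  apply contDiff_prod
  intro i _
  exact hg _ _

lemma contDiff_inv_entry {n : ℕ} {k : WithTop ℕ∞} {g : En n → Matrix (Fin n) (Fin n) ℝ}
    (hg : ∀ i j, ContDiff ℝ k (fun x => g x i j)) (h0 : ∀ x, (g x).det ≠ 0) (i j : Fin n) :
    ContDiff ℝ k (fun x => (g x)⁻¹ i j) := by
  have : (fun x => (g x)⁻¹ i j) = fun x => ((g x).det)⁻¹ * ((g x).updateRow j (Pi.single i 1)).det := by
    funext x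
    rw [inv_def, Ring.inverse_eq_inv', Matrix.smul_apply, adjugate_apply, smul_eq_mul]
  rw [this]
  apply ((contDiff_det hg).inv h0).mul
  apply contDiff_det
  intro a b
  by_cases h : a = j
  · subst h; simp only [updateRow_self]; exact contDiff_const
  · simp only [updateRow_ne h]; exact hg a b

lemma contDiff_pdrv {n : ℕ} {f : En n → ℝ} (hf : ContDiff ℝ (⊤ : ℕ∞) f) (i : Fin n) :
    ContDiff ℝ (⊤ : ℕ∞) (fun x => pdrv n i f x) := by
  have h : ContDiff ℝ (⊤ : ℕ∞) (fderiv ℝ f) := hf.fderiv_right (by norm_cast)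
  exact h.clm_apply contDiff_const

lemma fderiv_coord {n : ℕ} (L : En n →L[ℝ] ℝ) (v : En n) :
    L v = ∑ j, L (EuclideanSpace.single j 1) * v j := by
  have : v = ∑ j, v j • EuclideanSpace.single j (1:ℝ) := by
    ext i
    simp [Pi.single_apply]
  conv_lhs => rw [this, map_sum]
  simp only [map_smul, smul_eq_mul, mul_comm]

/-- Lewy rotation map -/
def lewy (n : ℕ) (u : En n → ℝ) (m : ℝ) (x : En n) : En n :=
  WithLp.toLp 2 (fun i => pdrv n i u x + m * x i)

lemma contDiff_lewy {n : ℕ} {u : En n → ℝ} (hu : ContDiff ℝ (⊤ : ℕ∞) u) (m : ℝ) :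
    ContDiff ℝ 1 (lewy n u m) := by
  rw [contDiff_euclidean]
  intro i
  have h1 : ContDiff ℝ 1 (fun x => pdrv n i u x) := (contDiff_pdrv hu i).of_le (by norm_cast)
  have h2 : ContDiff ℝ 1 (fun x : En n => x i) := (EuclideanSpace.proj (𝕜 := ℝ) i).contDiff
  exact h1.add (contDiff_const.mul h2)

lemma fderiv_lewy {n : ℕ} {u : En n → ℝ} (hu : ContDiff ℝ (⊤ : ℕ∞) u) (m : ℝ) (x v : En n) :
    ((fderiv ℝ (lewy n u m) x v : En n) : Fin n → ℝ) =
      (hess n u x + m • (1 : Matrix (Fin n) (Fin n) ℝ)) *ᵥ (v : Fin n → ℝ) := by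
  have hd := ((contDiff_lewy hu m).differentiable one_ne_zero x).hasFDerivAt
  funext i
  have h1 : HasFDerivAt (fun y => lewy n u m y i) ((EuclideanSpace.proj (𝕜 := ℝ) i).comp (fderiv ℝ (lewy n u m) x)) x :=
    (EuclideanSpace.proj (𝕜 := ℝ) i).hasFDerivAt.comp x hd
  have h2 : HasFDerivAt (fun y : En n => pdrv n i u y + m * y i)
      (fderiv ℝ (fun y => pdrv n i u y) x + m • (EuclideanSpace.proj (𝕜 := ℝ) i : En n →L[ℝ] ℝ)) x := by
    have := ((contDiff_pdrv hu i).differentiable (by simp) x).hasFDerivAt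
    exact this.add ((EuclideanSpace.proj (𝕜 := ℝ) i : En n →L[ℝ] ℝ).hasFDerivAt.const_mul m)
  have h3 := congrArg (fun L => L v) (h1.unique h2)
  have h4 : (fderiv ℝ (lewy n u m) x v : En n) i = fderiv ℝ (fun y => pdrv n i u y) x v + m * v i := h3
  rw [h4, fderiv_coord (fderiv ℝ (fun y => pdrv n i u y) x) v, add_mulVec, smul_mulVec, one_mulVec]
  rfl

lemma det_lewy {n : ℕ} {u : En n → ℝ} (hu : ContDiff ℝ (⊤ : ℕ∞) u) (m : ℝ) (x : En n) :
    (fderiv ℝ (lewy n u m) x).det = (hess n u x + m • (1 : Matrix (Fin n) (Fin n) ℝ)).det := by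
  have : ((fderiv ℝ (lewy n u m) x : En n →L[ℝ] En n) : En n →ₗ[ℝ] En n) =
      Matrix.toLin (PiLp.basisFun 2 ℝ (Fin n)) (PiLp.basisFun 2 ℝ (Fin n))
        (hess n u x + m • (1 : Matrix (Fin n) (Fin n) ℝ)) := by
    rw [← Matrix.toLpLin_eq_toLin]
    ext1 v
    apply (WithLp.ofLp_injective 2)
    exact fderiv_lewy hu m x v
  rw [ContinuousLinearMap.det, this, LinearMap.det_toLin]

section
set_option maxSynthPendingDepth 3

/-- coordinates of a covector -/
def cov {n : ℕ} (ξ : En n →L[ℝ] ℝ) : Fin n → ℝ := fun i => ξ (EuclideanSpace.single i 1)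

/-- bilinear form on covectors from a matrix -/
def bil {n : ℕ} (A : Matrix (Fin n) (Fin n) ℝ) : (En n →L[ℝ] ℝ) →L[ℝ] (En n →L[ℝ] ℝ) →L[ℝ] ℝ :=
  ∑ i, ∑ j, A i j • (ContinuousLinearMap.apply ℝ ℝ (EuclideanSpace.single i (1:ℝ) : En n)).smulRight
    (ContinuousLinearMap.apply ℝ ℝ (EuclideanSpace.single j (1:ℝ) : En n))

lemma bil_apply {n : ℕ} (A : Matrix (Fin n) (Fin n) ℝ) (ξ ζ : En n →L[ℝ] ℝ) :
    bil A ξ ζ = cov ξ ⬝ᵥ (A *ᵥ cov ζ) := by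
  simp only [bil, _root_.sum_apply, _root_.smul_apply,
    ContinuousLinearMap.smulRight_apply, ContinuousLinearMap.apply_apply, smul_eq_mul,
    dotProduct, mulVec, cov, Finset.mul_sum]
  refine Finset.sum_congr rfl fun i _ => Finset.sum_congr rfl fun j _ => ?_
  ring

lemma cov_vec {n : ℕ} (ξ : En n →L[ℝ] ℝ) : ∃ v : En n, (v : Fin n → ℝ) = cov ξ ∧ ‖v‖ = ‖ξ‖ := by
  refine ⟨(InnerProductSpace.toDual ℝ (En n)).symm ξ, ?_, LinearIsometryEquiv.norm_map _ _⟩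
  funext i
  have h := InnerProductSpace.toDual_symm_apply (𝕜 := ℝ) (x := (EuclideanSpace.single i 1 : En n)) (y := ξ)
  rw [EuclideanSpace.inner_single_right] at h
  simpa [cov] using h

lemma weak_x {n : ℕ} (V : Fin n → Fin n → En n → ℝ) (hV : ∀ i j, ContDiff ℝ 1 (V i j))
    (h0 : ∀ x, ∑ i, ∑ j, pdrv n j (V i j) x = 0) (ψ : En n → ℝ) (hψ : ContDiff ℝ 1 ψ)
    (hc : HasCompactSupport ψ) :
    ∫ x, ∑ i, ∑ j, V i j x * pdrv n j ψ x = 0 := by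
  have cp : ∀ (j : Fin n) (h : En n → ℝ), ContDiff ℝ 1 h → Continuous (fun x => pdrv n j h x) := by
    intro j h hh
    exact (hh.continuous_fderiv one_ne_zero).clm_apply continuous_const
  have i1 : ∀ i j, Integrable (fun x => V i j x * pdrv n j ψ x) := by
    intro i j
    apply integrable_off hc ((hV i j).continuous.mul (cp j ψ hψ))
    intro x hx
    simp [pdrv, fderiv_off hx]
  have i2 : ∀ i j, Integrable (fun x => pdrv n j (V i j) x * ψ x) := by
    intro i j
    apply integrable_off hc ((cp j _ (hV i j)).mul hψ.continuous)
    intro x hx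
    simp [image_eq_zero_of_notMem_tsupport hx]
  have i3 : ∀ i j, Integrable (fun x => V i j x * ψ x) := by
    intro i j
    apply integrable_off hc ((hV i j).continuous.mul hψ.continuous)
    intro x hx
    simp [image_eq_zero_of_notMem_tsupport hx]
  have key : ∀ i j, ∫ x, V i j x * pdrv n j ψ x = - ∫ x, pdrv n j (V i j) x * ψ x := by
    intro i j
    exact integral_mul_fderiv_eq_neg_fderiv_mul_of_integrable (i2 i j) (i1 i j) (i3 i j)
      (fun x _ => (hV i j).differentiable one_ne_zero x) (fun x _ => hψ.differentiable one_ne_zero x)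
  rw [integral_finsetSum _ (fun i _ => integrable_finsetSum _ (fun j _ => i1 i j))]
  have : ∀ i, ∫ x, ∑ j, V i j x * pdrv n j ψ x = - ∫ x, ∑ j, pdrv n j (V i j) x * ψ x := by
    intro i
    rw [integral_finsetSum _ (fun j _ => i1 i j), integral_finsetSum _ (fun j _ => i2 i j),
      ← Finset.sum_neg_distrib]
    exact Finset.sum_congr rfl fun j _ => key i j
  simp only [this]
  rw [Finset.sum_neg_distrib, ← integral_finsetSum _ (fun i _ => integrable_finsetSum _ (fun j _ => i2 i j))]
  simp only [← Finset.sum_mul, h0, zero_mul, integral_zero, neg_zero]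

lemma pdrv_comp_lewy {n : ℕ} {u : En n → ℝ} (hu : ContDiff ℝ (⊤ : ℕ∞) u) (m : ℝ) (h : En n → ℝ)
    (hh : ContDiff ℝ 1 h) (x : En n) (i : Fin n) :
    pdrv n i (fun y => h (lewy n u m y)) x =
      (cov (fderiv ℝ h (lewy n u m x)) ᵥ* (hess n u x + m • (1 : Matrix (Fin n) (Fin n) ℝ))) i := by
  have hd := ((contDiff_lewy hu m).differentiable one_ne_zero x).hasFDerivAt
  have h1 := ((hh.differentiable one_ne_zero (lewy n u m x)).hasFDerivAt).comp x hd
  have h2 : fderiv ℝ (fun y => h (lewy n u m y)) x = _ := h1.fderiv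
  simp only [pdrv]
  rw [h2, ContinuousLinearMap.comp_apply, fderiv_coord, vecMul, dotProduct]
  refine Finset.sum_congr rfl fun k _ => ?_
  rw [fderiv_lewy hu]
  simp [cov]

lemma liouville_main
    (n : ℕ) (hn : 1 ≤ n)
    (u : En n → ℝ) (hu : ContDiff ℝ (⊤ : ℕ∞) u) (M : ℝ) (hM : 0 ≤ M)
    (hsemi : ∀ x, (hess n u x + M • (1 : Matrix (Fin n) (Fin n) ℝ)).PosSemidef)
    (f : En n → ℝ) (hf : ContDiff ℝ (⊤ : ℕ∞) f)
    (hbdd : ∃ C : ℝ, ∀ x, |f x| ≤ C)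
    (hharm : ∀ x, lapBel n (fun y => 1 + hess n u y * hess n u y) f x = 0) :
    ∀ x y, f x = f y := by
  have hH : ∀ x, (hess n u x).IsHermitian := by
    intro x
    have h1 := (hsemi x).isHermitian
    have h2 : (M • (1 : Matrix (Fin n) (Fin n) ℝ)).IsHermitian := by
      rw [smul_one_eq_diagonal]; exact isHermitian_diagonal _
    simpa using h1.sub h2
  have hHt : ∀ x, (hess n u x)ᵀ = hess n u x := fun x => by
    rw [← conjTranspose_eq_transpose_of_trivial]; exact hH x
  have one_le : (1 : WithTop ℕ∞) ≤ ((⊤ : ℕ∞) : WithTop ℕ∞) := by norm_cast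
  set m := M + 1 with hm
  have hdb := fun x => det_bounds (hess n u x) M hM (hH x) (hsemi x)
  obtain ⟨lam, Lam, hl0, hL0, hell⟩ := mat_ell (n := n) M hM
  -- smoothness
  have sH : ∀ i j, ContDiff ℝ 1 (fun x => hess n u x i j) := fun i j =>
    (contDiff_pdrv (contDiff_pdrv hu i) j).of_le one_le
  have sg : ∀ i j, ContDiff ℝ 1 (fun x => (1 + hess n u x * hess n u x) i j) := by
    intro i j
    simp only [Matrix.add_apply, mul_apply]
    exact contDiff_const.add (ContDiff.sum fun k _ => (sH i k).mul (sH k j))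
  have sdet := contDiff_det sg
  have ssq : ContDiff ℝ 1 (fun x => √(1 + hess n u x * hess n u x).det) :=
    sdet.sqrt (fun x => (hdb x).1.ne')
  have sinv := contDiff_inv_entry sg (fun x => (hdb x).1.ne')
  let V : Fin n → Fin n → En n → ℝ := fun i j y =>
    √(1 + hess n u y * hess n u y).det * (1 + hess n u y * hess n u y)⁻¹ i j * pdrv n i f y
  have hV : ∀ i j, ContDiff ℝ 1 (V i j) := fun i j =>
    (ssq.mul (sinv i j)).mul ((contDiff_pdrv hf i).of_le one_le)
  -- the Lewy map
  have hLc := contDiff_lewy hu m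
  obtain ⟨e, he, hes⟩ := global_inv (lewy n u m) hLc (by
    intro x v
    have h1 := (hsemi x).dotProduct_mulVec_nonneg (v : Fin n → ℝ)
    simp only [star_trivial] at h1
    rw [real_inner_comm, inner_eq_dot, fderiv_lewy hu, hm, add_smul, one_smul, ← add_assoc,
      add_mulVec (_ + M • 1), one_mulVec, dotProduct_add, ← real_inner_self_eq_norm_sq, inner_eq_dot]
    linarith)
  let f' : En n → ℝ := fun y => f (e.symm y)
  have hf1 : ContDiff ℝ 1 f := hf.of_le one_le
  have hf' : ContDiff ℝ 1 f' := hf1.comp hes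
  have hff : f = fun y => f' (lewy n u m y) := by
    funext y; simp only [f']; rw [← he, e.symm_apply_apply]
  let a : En n → (En n →L[ℝ] ℝ) →L[ℝ] (En n →L[ℝ] ℝ) →L[ℝ] ℝ := fun y =>
    bil (Amat (hess n u (e.symm y)) m)
  have cA : ∀ i j, Continuous (fun x => Amat (hess n u x) m i j) := by
    have cH : Continuous (fun x => hess n u x) :=
      continuous_matrix fun i j => (sH i j).continuous
    have cK : Continuous (fun x => hess n u x + m • (1 : Matrix (Fin n) (Fin n) ℝ)) :=
      cH.add continuous_const
    have cI : Continuous (fun x => (1 + hess n u x * hess n u x)⁻¹) :=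
      continuous_matrix fun i j => (sinv i j).continuous
    have c1 := (cK.matrix_mul cI).matrix_mul cK
    have c2 : Continuous (fun x => √(1 + hess n u x * hess n u x).det /
        |(hess n u x + m • (1 : Matrix (Fin n) (Fin n) ℝ)).det|) := by
      refine ssq.continuous.div cK.matrix_det.abs ?_
      intro x
      have := (hdb x).2.1
      exact abs_ne_zero.2 (by linarith)
    intro i j
    exact c2.mul (c1.matrix_elem i j)
  have ha : Ell n a lam Lam := by
    refine ⟨hl0, hL0, ?_, ?_, ?_⟩
    · simp only [a, bil]
      refine continuous_finsetSum _ fun i _ => continuous_finsetSum _ fun j _ => ?_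
      exact ((cA i j).comp e.symm.continuous).smul continuous_const
    · intro y ξ
      obtain ⟨v, hv, hn⟩ := cov_vec ξ
      simp only [a]
      rw [bil_apply, ← hn, ← hv]
      exact (hell _ (hH _) (hsemi _)).1 v
    · intro y ξ ζ
      obtain ⟨v, hv, hn⟩ := cov_vec ξ
      obtain ⟨w, hw, hn'⟩ := cov_vec ζ
      simp only [a]
      rw [bil_apply, ← hn, ← hv, ← hn', ← hw]
      exact (hell _ (hH _) (hsemi _)).2 v w
  have hsol : WeakSol n a f' := by
    intro φ hφ hc
    let ψ : En n → ℝ := fun x => φ (lewy n u m x)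
    have hψ : ContDiff ℝ 1 ψ := hφ.comp hLc
    have hψc : HasCompactSupport ψ := by
      have := hc.comp_homeomorph e
      rw [he] at this
      exact this
    have hw := weak_x V hV hharm ψ hψ hψc
    have hcv := integral_image_eq_integral_abs_det_fderiv_smul volume (s := Set.univ)
      MeasurableSet.univ (f := lewy n u m) (f' := fun x => fderiv ℝ (lewy n u m) x)
      (fun x _ => ((hLc.differentiable one_ne_zero x).hasFDerivAt).hasFDerivWithinAt)
      (by rw [← he]; exact e.injective.injOn) (fun y => a y (fderiv ℝ f' y) (fderiv ℝ φ y))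
    have him : Set.image (lewy n u m) Set.univ = Set.univ := by
      rw [← he]; simp
    rw [him, Measure.restrict_univ] at hcv
    rw [hcv, ← hw]
    congr 1
    funext x
    have hsx : e.symm (lewy n u m x) = x := by rw [← he, e.symm_apply_apply]
    simp only [a, smul_eq_mul, V]
    rw [hsx, bil_apply, det_lewy hu]
    have hp : ∀ i, pdrv n i f x = _ := fun i =>
      (congrArg (fun h => pdrv n i h x) hff).trans (pdrv_comp_lewy hu m f' hf' x i)
    have hr : ∀ j, pdrv n j ψ x = _ := fun j => pdrv_comp_lewy hu m φ hφ x j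
    simp only [hp, hr]
    set p := cov (fderiv ℝ f' (lewy n u m x))
    set r := cov (fderiv ℝ φ (lewy n u m x))
    have hdet := (hdb x).2.1
    simp only [Amat]
    set K := hess n u x + m • (1 : Matrix (Fin n) (Fin n) ℝ) with hK
    have hKt : Kᵀ = K := by
      rw [hK, transpose_add, hHt, transpose_smul, transpose_one]
    set g := 1 + hess n u x * hess n u x
    have hd0 : |K.det| ≠ 0 := abs_ne_zero.2 (by linarith)
    have hrK : K *ᵥ r = r ᵥ* K := by rw [← mulVec_transpose, hKt]
    rw [smul_mulVec, dotProduct_smul, smul_eq_mul, ← mul_assoc, mul_div_cancel₀ _ hd0,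
      ← mulVec_mulVec, ← mulVec_mulVec, dotProduct_mulVec, hrK]
    simp only [dotProduct, mulVec, Finset.mul_sum]
    refine Finset.sum_congr rfl fun i _ => Finset.sum_congr rfl fun j _ => ?_
    ring
  have hfin := liouville_abs n hn lam Lam a ha f' hf' hsol (by
    obtain ⟨C, hC⟩ := hbdd
    exact ⟨C, fun x => hC _⟩)
  intro x y
  have := hfin (e x) (e y)
  simpa [f'] using this

end

/-- The gradient graph of a semiconvex function is a Liouville manifold: every bounded
harmonic function on it is constant. -/
theorem liouville_gradient_graph_of_semiconvex
    (n : ℕ) (hn : 1 ≤ n)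
    (u : En n → ℝ) (hu : ContDiff ℝ (⊤ : ℕ∞) u)
    (hsemi : ∃ M : ℝ, ∀ x,
      (hess n u x + M • (1 : Matrix (Fin n) (Fin n) ℝ)).PosSemidef)
    (f : En n → ℝ) (hf : ContDiff ℝ (⊤ : ℕ∞) f)
    (hbdd : ∃ C : ℝ, ∀ x, |f x| ≤ C)
    (hharm : ∀ x, lapBel n (fun y => 1 + hess n u y * hess n u y) f x = 0) :
    ∀ x y, f x = f y := by
  obtain ⟨M, hM⟩ := hsemi
  refine liouville_main n hn u hu (max M 0) (le_max_right _ _) (fun x => ?_) f hf hbdd hharm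
  have h1 : hess n u x + (max M 0) • (1 : Matrix (Fin n) (Fin n) ℝ)
      = (hess n u x + M • (1 : Matrix (Fin n) (Fin n) ℝ)) + (max M 0 - M) • (1 : Matrix (Fin n) (Fin n) ℝ) := by
    rw [sub_smul]; abel
  rw [h1]
  exact (hM x).add (PosSemidef.one.smul (sub_nonneg.2 (le_max_left _ _)))
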